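/- arXiv:2502.09576 — 4 statements merged into one kernel-verified Lean document; each statement's English description precedes it below -/
import Mathlib

section
/- Upper bound of Theorem 1.3: For every integer k ≥ 3 and every ε > 0 there exists n_0 such that the following holds for all n ≥ n_0. If G is an n-vertex maximal C_{2k−1}-free graph with minimum degree δ(G) ≥ (1/(2k−1) + ε)·n, then G is a blowup of some graph H with at most tw_k(r) vertices, where r = ⌈e(d+1)·(12ke/ε)^d⌉ and d = (2k−1)^3·binomial(2k−2, k−1)·2^{(2k−1)^{2k−2}}. -/
open SimpleGraph

/-- `G` contains a cycle of length `ℓ`. -/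
def HasCycleOfLength {V : Type*} (G : SimpleGraph V) (ℓ : ℕ) : Prop :=
  ∃ (v : V) (w : G.Walk v v), w.IsCycle ∧ w.length = ℓ

/-- `G` is maximal `C_ℓ`-free: it has no cycle of length `ℓ`, and adding any edge
between two non-adjacent vertices creates a cycle of length `ℓ`. -/
def MaximalCLFree {V : Type*} (G : SimpleGraph V) (ℓ : ℕ) : Prop :=
  ¬ HasCycleOfLength G ℓ ∧
    ∀ u v : V, u ≠ v → ¬ G.Adj u v →
      HasCycleOfLength (G ⊔ SimpleGraph.fromEdgeSet {s(u, v)}) ℓ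

/-- `G` is a blowup of `H`: there is a surjection `f` from the vertices of `G` onto
the vertices of `H` such that distinct `u, v` are adjacent in `G` iff their images
are adjacent in `H`. -/
def IsBlowupOf {V W : Type*} (G : SimpleGraph V) (H : SimpleGraph W) : Prop :=
  ∃ f : V → W, Function.Surjective f ∧
    ∀ u v : V, u ≠ v → (G.Adj u v ↔ H.Adj (f u) (f v))

/-- The tower function, `tw 0 x = x` and `tw (i+1) x = tw i x · 2 ^ (tw i x)`
(so `tw (i-1)` corresponds to the paper's `tw_i`). -/
def tw : ℕ → ℕ → ℕ
  | 0, x => x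
  | i + 1, x => tw i x * 2 ^ (tw i x)

/-- The bound on the VC-dimension from Theorem 1.5. -/
def vcBound (k : ℕ) : ℕ :=
  (2 * k - 1) ^ 3 * Nat.choose (2 * k - 2) (k - 1) * 2 ^ ((2 * k - 1) ^ (2 * k - 2))

/-- The first `L + 1` terms of `x` form a walk of length `L` in `G`. -/
def IsWalkSeq {V : Type*} (G : SimpleGraph V) (L : ℕ) (x : ℕ → V) : Prop :=
  ∀ i < L, G.Adj (x i) (x (i + 1))

/-- `a` and `b` are joined by a walk of length `L` inside `S`. -/
def HasWalk {V : Type*} (G : SimpleGraph V) (S : Set V) (L : ℕ) (a b : V) : Prop :=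
  ∃ x : ℕ → V, IsWalkSeq G L x ∧ x 0 = a ∧ x L = b ∧ ∀ i ≤ L, x i ∈ S

/-- `a` and `b` are joined by a path of length `L` inside `S`. -/
def HasPath {V : Type*} (G : SimpleGraph V) (S : Set V) (L : ℕ) (a b : V) : Prop :=
  ∃ x : ℕ → V, IsWalkSeq G L x ∧ Set.InjOn x (Set.Iic L) ∧ x 0 = a ∧ x L = b ∧ ∀ i ≤ L, x i ∈ S

section Paths

variable {V : Type*} {G : SimpleGraph V} {S T : Set V} {L M : ℕ} {a b c : V}

lemma HasPath.hasWalk (h : HasPath G S L a b) : HasWalk G S L a b := by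
  obtain ⟨x, h1, -, h3⟩ := h
  exact ⟨x, h1, h3⟩

lemma HasPath.mono (h : HasPath G S L a b) (hST : S ⊆ T) : HasPath G T L a b := by
  obtain ⟨x, h1, h2, h3, h4, h5⟩ := h
  exact ⟨x, h1, h2, h3, h4, fun i hi => hST (h5 i hi)⟩

lemma HasWalk.mono (h : HasWalk G S L a b) (hST : S ⊆ T) : HasWalk G T L a b := by
  obtain ⟨x, h1, h3, h4, h5⟩ := h
  exact ⟨x, h1, h3, h4, fun i hi => hST (h5 i hi)⟩

lemma HasPath.symm (h : HasPath G S L a b) : HasPath G S L b a := by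
  obtain ⟨x, h1, h2, h3, h4, h5⟩ := h
  refine ⟨fun i => x (L - i), fun i hi => ?_, fun i hi j hj hij => ?_, ?_, ?_, ?_⟩
  · have := h1 (L - (i + 1)) (by lia)
    rw [show L - (i + 1) + 1 = L - i by lia] at this
    exact this.symm
  · have := h2 (show L - i ∈ Set.Iic L by simp) (show L - j ∈ Set.Iic L by simp) hij
    simp only [Set.mem_Iic] at hi hj
    lia
  · simpa using h4
  · simpa using h3
  · intro i hi
    exact h5 _ (by lia)

lemma HasWalk.append (h : HasWalk G S L a b) (h' : HasWalk G S M b c) :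
    HasWalk G S (L + M) a c := by
  obtain ⟨x, h1, h3, h4, h5⟩ := h
  obtain ⟨y, g1, g3, g4, g5⟩ := h'
  refine ⟨fun i => if i ≤ L then x i else y (i - L), fun i hi => ?_, ?_, ?_, ?_⟩
  · by_cases hL : i + 1 ≤ L
    · simp only [hL, show i ≤ L by lia, if_true]
      exact h1 i (by lia)
    · simp only [hL, if_false]
      by_cases hL' : i ≤ L
      · obtain rfl : i = L := by lia
        simp only [le_refl, if_true, h4]
        rw [← g3, show i + 1 - i = 0 + 1 by lia]
        exact g1 0 (by lia)
      · simp only [hL', if_false]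
        rw [show i + 1 - L = i - L + 1 by lia]
        exact g1 _ (by lia)
  · simpa using h3
  · by_cases hM : M = 0
    · subst hM
      simp [h4, ← g4, g3]
    · simp [hM, g4]
  · intro i hi
    by_cases hL : i ≤ L
    · simpa [hL] using h5 i hL
    · simpa [hL] using g5 (i - L) (by lia)

lemma HasPath.append (h : HasPath G S L a b) (h' : HasPath G T M b c)
    (hST : ∀ v ∈ S, v ∈ T → v = b) : HasPath G (S ∪ T) (L + M) a c := by
  obtain ⟨x, h1, h2, h3, h4, h5⟩ := h
  obtain ⟨y, g1, g2, g3, g4, g5⟩ := h'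
  have key : ∀ i ≤ L, ∀ j ≤ L + M, L < j → x i ≠ y (j - L) := by
    intro i hi j hj hLj he
    have hb := hST _ (h5 i hi) (he ▸ g5 (j - L) (by lia))
    have := g2 (show j - L ∈ Set.Iic M by simp; lia) (show 0 ∈ Set.Iic M by simp)
      (by rw [← he, hb, g3])
    lia
  refine ⟨fun i => if i ≤ L then x i else y (i - L), fun i hi => ?_, ?_, ?_, ?_, ?_⟩
  · by_cases hL : i + 1 ≤ L
    · simp only [hL, show i ≤ L by lia, if_true]
      exact h1 i (by lia)
    · simp only [hL, if_false]
      by_cases hL' : i ≤ L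
      · obtain rfl : i = L := by lia
        simp only [le_refl, if_true, h4]
        rw [← g3, show i + 1 - i = 0 + 1 by lia]
        exact g1 0 (by lia)
      · simp only [hL', if_false]
        rw [show i + 1 - L = i - L + 1 by lia]
        exact g1 _ (by lia)
  · intro i hi j hj hij
    simp only [Set.mem_Iic] at hi hj
    by_cases hL : i ≤ L <;> by_cases hL' : j ≤ L <;> simp only [hL, hL', if_true, if_false] at hij
    · exact h2 hL hL' hij
    · exact absurd hij (key i hL j hj (by lia))
    · exact absurd hij.symm (key j hL' i hi (by lia))
    · have := g2 (show i - L ∈ Set.Iic M by simp; lia) (show j - L ∈ Set.Iic M by simp; lia) hij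
      lia
  · simpa using h3
  · by_cases hM : M = 0
    · subst hM
      simp [h4, ← g4, g3]
    · simp [hM, g4]
  · intro i hi
    by_cases hL : i ≤ L
    · simpa [hL] using Or.inl (h5 i hL)
    · simpa [hL] using Or.inr (g5 (i - L) (by lia))

lemma HasPath.single (h : G.Adj a b) : HasPath G {a, b} 1 a b := by
  refine ⟨fun i => if i = 0 then a else b, fun i hi => ?_, fun i hi j hj hij => ?_, ?_, ?_, ?_⟩
  · obtain rfl : i = 0 := by lia
    simpa using h
  · simp only [Set.mem_Iic] at hi hj
    have := h.ne
    have hi' : i = 0 ∨ i = 1 := by lia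
    have hj' : j = 0 ∨ j = 1 := by lia
    rcases hi' with rfl | rfl <;> rcases hj' with rfl | rfl <;> simp_all
  · simp
  · simp
  · intro i hi
    by_cases h : i = 0 <;> simp [h]

lemma HasPath.refl (ha : a ∈ S) : HasPath G S 0 a a :=
  ⟨fun _ => a, fun i hi => by lia, fun i hi j hj _ => by simp at hi hj; lia, rfl, rfl,
    fun _ _ => ha⟩

lemma HasWalk.single (h : G.Adj a b) (ha : a ∈ S) (hb : b ∈ S) : HasWalk G S 1 a b :=
  (HasPath.single h).hasWalk.mono (by intro v hv; rcases hv with rfl | rfl <;> assumption)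

/-- Prepending an edge to a path. -/
lemma HasPath.cons (h : G.Adj a b) (h' : HasPath G T M b c) (ha : a ∉ T) :
    HasPath G (insert a T) (M + 1) a c := by
  obtain ⟨y, g⟩ := h'
  have hb : b ∈ T := by
    have := g.2.2.2.2 0 (by lia)
    rwa [g.2.2.1] at this
  have := (HasPath.single h).append ⟨y, g⟩ (by
    intro v hv hT
    rcases hv with rfl | rfl
    · exact absurd hT ha
    · rfl)
  rw [add_comm]
  refine this.mono ?_
  intro v hv
  rcases hv with (rfl | rfl) | hv
  · simp
  · simp [hb]
  · simp [hv]

lemma IsWalkSeq.segment {x : ℕ → V} (hx : IsWalkSeq G L x) {i j : ℕ} (hij : i ≤ j) (hj : j ≤ L) :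
    HasWalk G (x '' Set.Icc i j) (j - i) (x i) (x j) := by
  refine ⟨fun m => x (i + m), fun m hm => ?_, rfl, by simp [hij], fun m hm => ?_⟩
  · exact hx (i + m) (by lia)
  · exact ⟨i + m, ⟨by lia, by lia⟩, rfl⟩

lemma IsWalkSeq.path_segment {x : ℕ → V} (hx : IsWalkSeq G L x) (hinj : Set.InjOn x (Set.Iic L))
    {i j : ℕ} (hij : i ≤ j) (hj : j ≤ L) :
    HasPath G (x '' Set.Icc i j) (j - i) (x i) (x j) := by
  refine ⟨fun m => x (i + m), fun m hm => ?_, fun m hm m' hm' h => ?_, rfl, by simp [hij],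
    fun m hm => ?_⟩
  · exact hx (i + m) (by lia)
  · simp only [Set.mem_Iic] at hm hm'
    have := hinj (show i + m ∈ Set.Iic L by simp; lia) (show i + m' ∈ Set.Iic L by simp; lia) h
    lia
  · exact ⟨i + m, ⟨by lia, by lia⟩, rfl⟩

lemma IsWalkSeq.exists_walk {x : ℕ → V} :
    ∀ {L : ℕ}, IsWalkSeq G L x → ∃ w : G.Walk (x 0) (x L), w.length = L ∧
      ∀ i ≤ L, w.getVert i = x i := by
  intro L
  induction L with
  | zero => intro _; exact ⟨.nil, rfl, fun i hi => by simp [Nat.le_zero.1 hi]⟩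
  | succ L ih =>
    intro h
    obtain ⟨w, hw, hw'⟩ := ih (fun i hi => h i (by lia))
    refine ⟨w.concat (h L (by lia)), by simp [hw], fun i hi => ?_⟩
    rw [SimpleGraph.Walk.concat_eq_append, Walk.getVert_append]
    by_cases h1 : i < L
    · simp [hw, h1, hw' i h1.le]
    · rcases (show i = L ∨ i = L + 1 by lia) with rfl | rfl
      · simp [hw]
      · simp [hw]

/-- A path of length `L ≥ 2` between adjacent vertices closes up to a cycle. -/
lemma HasPath.hasCycleOfLength (h : HasPath G S L a b) (hL : 2 ≤ L) (hab : G.Adj a b) :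
    HasCycleOfLength G (L + 1) := by
  obtain ⟨x, h1, h2, h3, h4, h5⟩ := h
  obtain ⟨w, hw, hw'⟩ := h1.exists_walk
  have hp : w.IsPath := by
    rw [← Walk.IsPath.getVert_injOn_iff]
    intro i hi j hj hij
    simp only [Set.mem_ofPred_eq, hw] at hi hj
    rw [hw' i hi, hw' j hj] at hij
    exact h2 hi hj hij
  subst h3 h4
  refine ⟨x L, .cons hab.symm w, ?_, by simp [hw]⟩
  rw [Walk.cons_isCycle_iff]
  refine ⟨hp, fun he => ?_⟩
  have := hp.length_eq_one_of_mem_edges (Sym2.eq_swap ▸ he)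
  lia

end Paths

section Maximal

variable {V : Type*} {G : SimpleGraph V}

/-- In a maximal `C_ℓ`-free graph, non-adjacent vertices are joined by a path of length `ℓ - 1`. -/
lemma MaximalCLFree.hasPath {ℓ : ℕ} (h : MaximalCLFree G ℓ) {u v : V} (huv : u ≠ v)
    (hadj : ¬ G.Adj u v) : HasPath G Set.univ (ℓ - 1) u v := by
  obtain ⟨a, w, hw, hwl⟩ := h.2 u v huv hadj
  have h3 : 3 ≤ ℓ := hwl ▸ hw.three_le_length
  have hinj := hw.getVert_injOn'
  rw [hwl] at hinj
  set c := w.getVert with hc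
  have hc0 : c 0 = c ℓ := by rw [hc, ← hwl]; simp
  have hcadj : ∀ i < ℓ, G.Adj (c i) (c (i + 1)) ∨ s(c i, c (i + 1)) = s(u, v) := by
    intro i hi
    have := w.adj_getVert_succ (i := i) (by lia)
    rw [SimpleGraph.sup_adj, SimpleGraph.fromEdgeSet_adj] at this
    rcases this with h1 | h1
    · exact Or.inl h1
    · exact Or.inr h1.1
  have hinj' : ∀ i < ℓ, ∀ j < ℓ, c i = c j → i = j := fun i hi j hj hij =>
    hinj (show i ≤ ℓ - 1 by lia) (show j ≤ ℓ - 1 by lia) hij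
  have hex : ∃ i < ℓ, ¬ G.Adj (c i) (c (i + 1)) := by
    by_contra! hall
    have hp : HasPath G Set.univ (ℓ - 1) (c 0) (c (ℓ - 1)) :=
      ⟨c, fun i hi => hall i (by lia), hinj, rfl, rfl, by simp⟩
    have hl := hall (ℓ - 1) (by lia)
    rw [show ℓ - 1 + 1 = ℓ by lia, ← hc0] at hl
    have := hp.hasCycleOfLength (by lia) hl.symm
    rw [show ℓ - 1 + 1 = ℓ by lia] at this
    exact h.1 this
  obtain ⟨i, hi, hia⟩ := hex
  have hiuv : s(c i, c (i + 1)) = s(u, v) := (hcadj i hi).resolve_left hia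
  have hother : ∀ j < ℓ, j ≠ i → G.Adj (c j) (c (j + 1)) := by
    intro j hj hji
    refine (hcadj j hj).resolve_right fun hjuv => ?_
    rw [← hiuv, Sym2.eq_iff] at hjuv
    rcases hjuv with ⟨h1, -⟩ | ⟨h1, h2⟩
    · exact hji (hinj' _ hj _ hi h1)
    · have e1 : i + 1 = j ∨ (i + 1 = ℓ ∧ j = 0) := by
        rcases (show i + 1 < ℓ ∨ i + 1 = ℓ by lia) with h' | h'
        · exact Or.inl (hinj' _ hj _ h' h1).symm
        · right
          rw [h', ← hc0] at h1
          exact ⟨h', hinj' _ hj _ (by lia) h1⟩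
      have e2 : j + 1 = i ∨ (j + 1 = ℓ ∧ i = 0) := by
        rcases (show j + 1 < ℓ ∨ j + 1 = ℓ by lia) with h' | h'
        · exact Or.inl (hinj' _ h' _ hi h2)
        · right
          rw [h', ← hc0] at h2
          exact ⟨h', (hinj' _ (by lia) _ hi h2).symm⟩
      lia
  have hp : HasPath G Set.univ (ℓ - 1) (c (i + 1)) (c i) := by
    refine ⟨fun j => if i + 1 + j ≤ ℓ then c (i + 1 + j) else c (i + 1 + j - ℓ), ?_, ?_, ?_, ?_,
      by simp⟩
    · intro j hj
      dsimp only
      rcases lt_trichotomy (i + 1 + j) ℓ with h' | h' | h'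
      · rw [if_pos h'.le, if_pos (by lia)]
        exact hother (i + 1 + j) h' (by lia)
      · rw [if_pos h'.le, if_neg (by lia), h', ← hc0,
          show i + 1 + (j + 1) - ℓ = 0 + 1 by lia]
        exact hother 0 (by lia) (by lia)
      · rw [if_neg (by lia), if_neg (by lia),
          show i + 1 + (j + 1) - ℓ = i + 1 + j - ℓ + 1 by lia]
        exact hother _ (by lia) (by lia)
    · have key : ∀ j ≤ ℓ - 1, ∃ m < ℓ, (if i + 1 + j ≤ ℓ then c (i + 1 + j)
          else c (i + 1 + j - ℓ)) = c m ∧ (m = i + 1 + j ∨ m + ℓ = i + 1 + j) := by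
        intro j hj
        rcases lt_trichotomy (i + 1 + j) ℓ with h' | h' | h'
        · exact ⟨i + 1 + j, h', by rw [if_pos h'.le], Or.inl rfl⟩
        · exact ⟨0, by lia, by rw [if_pos h'.le, h', ← hc0], Or.inr (by lia)⟩
        · exact ⟨i + 1 + j - ℓ, by lia, by rw [if_neg (by lia)], Or.inr (by lia)⟩
      intro j hj j' hj' hjj
      obtain ⟨m, hm, hm1, hm2⟩ := key j hj
      obtain ⟨m', hm', hm1', hm2'⟩ := key j' hj'
      have := hinj' m hm m' hm' (by rw [← hm1, ← hm1']; exact hjj)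
      simp only [Set.mem_Iic] at hj hj'
      lia
    · simp only [add_zero, if_pos (show i + 1 ≤ ℓ by lia)]
    · rcases (show i = 0 ∨ 0 < i by lia) with h' | h'
      · subst h'
        dsimp only
        rw [if_pos (by lia), show 0 + 1 + (ℓ - 1) = ℓ by lia, ← hc0]
      · dsimp only
        rw [if_neg (by lia), show i + 1 + (ℓ - 1) - ℓ = i by lia]
  rw [Sym2.eq_iff] at hiuv
  rcases hiuv with ⟨h1, h2⟩ | ⟨h1, h2⟩
  · rw [h1, h2] at hp
    exact hp.symm
  · rwa [h1, h2] at hp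

end Maximal

open Classical in
/-- The neighbourhood of a vertex, as a finset. -/
noncomputable def nbr {V : Type*} [Fintype V] (G : SimpleGraph V) (v : V) : Finset V :=
  {w | G.Adj v w}

/-- The number of common neighbours of two vertices. -/
noncomputable def cod {V : Type*} [Fintype V] [DecidableEq V] (G : SimpleGraph V) (x y : V) : ℕ :=
  (nbr G x ∩ nbr G y).card

/-- The facts on a dense maximal `C_{2k-1}`-free graph which the argument uses: `4 * q` bounds the
degrees from below, any `2 * k - 1` vertices contain two with `4 * q` common neighbours, the order
of `G` is at most `A * q / 2`, and `K` is a constant which is much smaller than `q`. -/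
structure DenseMaximal {V : Type*} [Fintype V] [DecidableEq V] (G : SimpleGraph V)
    (k q A K : ℕ) : Prop where
  three_le : 3 ≤ k
  not_path : ∀ u v, G.Adj u v → ¬ HasPath G Set.univ (2 * k - 2) u v
  path : ∀ u v, u ≠ v → ¬ G.Adj u v → HasPath G Set.univ (2 * k - 2) u v
  deg : ∀ v, 4 * q ≤ (nbr G v).card
  pigeon : ∀ T : Finset V, T.card = 2 * k - 1 → ∃ x ∈ T, ∃ y ∈ T, x ≠ y ∧ 4 * q ≤ cod G x y
  card_le : 2 * Fintype.card V ≤ A * q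
  le_K : 6 * k ≤ K
  one_le_A : 1 ≤ A
  mul_le : A * K ≤ q

section Jump

@[simp]
lemma mem_nbr {V : Type*} [Fintype V] {G : SimpleGraph V} {v w : V} : w ∈ nbr G v ↔ G.Adj v w := by
  simp [nbr]

variable {V : Type*} [Fintype V] [DecidableEq V] {G : SimpleGraph V} {k q A K : ℕ}

lemma cod_comm (x y : V) : cod G x y = cod G y x := by
  rw [cod, cod, Finset.inter_comm]

lemma DenseMaximal.K_le (h : DenseMaximal G k q A K) : K ≤ q :=
  (Nat.le_mul_of_pos_left K h.one_le_A).trans h.mul_le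

/-- Vertices with many common neighbours are joined by paths of all short even lengths, which
avoid any given small set. -/
lemma DenseMaximal.jump (h : DenseMaximal G k q A K) (g : ℕ) :
    ∀ (x y : V) (F : Finset V), x ≠ y → F.card + 2 * (g + 1) + 2 * k ≤ cod G x y →
      F.card + 2 * (g + 1) + 2 * k ≤ 4 * q →
      HasPath G {v | v = x ∨ v = y ∨ v ∉ F} (2 * (g + 1)) x y := by
  have hk := h.three_le
  induction g with
  | zero =>
    intro x y F hxy h1 h2
    have : F.card < (nbr G x ∩ nbr G y).card := by
      rw [cod] at h1
      lia
    obtain ⟨z, hz, hzF⟩ := Finset.exists_mem_notMem_of_card_lt_card this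
    simp only [Finset.mem_inter, mem_nbr] at hz
    refine (HasPath.cons hz.1 (HasPath.single hz.2.symm) ?_).mono ?_
    · rintro (rfl | rfl)
      · exact hz.1.ne rfl
      · exact hxy rfl
    · rintro v (rfl | rfl | rfl) <;> simp [hzF]
  | succ g ih =>
    intro x y F hxy h1 h2
    have hle : 2 * k - 1 ≤ ((nbr G x ∩ nbr G y) \ F).card := by
      have := Finset.le_card_sdiff F (nbr G x ∩ nbr G y)
      rw [cod] at h1
      lia
    obtain ⟨T, hT, hTc⟩ := Finset.exists_subset_card_eq hle
    obtain ⟨x', hx', y', hy', hne, hc⟩ := h.pigeon T hTc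
    have hx'' := hT hx'
    have hy'' := hT hy'
    simp only [Finset.mem_sdiff, Finset.mem_inter, mem_nbr] at hx'' hy''
    have hcard : (insert x (insert y F)).card ≤ F.card + 2 :=
      (Finset.card_insert_le _ _).trans (by have := Finset.card_insert_le y F; lia)
    have hp := ih x' y' (insert x (insert y F)) hne (by lia) (by lia)
    have hp1 := hp.cons hx''.1.1 (by
      simp only [Set.mem_ofPred_eq, not_or, not_not]
      exact ⟨hx''.1.1.ne, hy''.1.1.ne, by simp⟩)
    have hp2 := hp1.symm.cons hy''.1.2 (by
      simp only [Set.mem_insert_iff, Set.mem_ofPred_eq, not_or, not_not]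
      exact ⟨hxy.symm, hx''.1.2.ne, hy''.1.2.ne, by simp⟩)
    refine hp2.symm.mono ?_
    rintro v (rfl | rfl | rfl | rfl | hv)
    · simp
    · simp
    · simp [hx''.2]
    · simp [hy''.2]
    · simp only [Finset.mem_insert, not_or] at hv
      simp [hv.2.2]

/-- Vertices with many common neighbours are not joined by a short odd path. -/
lemma DenseMaximal.no_odd_path (h : DenseMaximal G k q A K) {x y : V} {S : Set V} {L : ℕ}
    (hc : K ≤ cod G x y) (hp : HasPath G S L x y) (hodd : Odd L) (hL : L ≤ 2 * k - 3) : False := by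
  have hk := h.three_le
  have hK := h.le_K
  have hq := h.K_le
  obtain ⟨a, ha, hinj, rfl, rfl, -⟩ := hp
  obtain ⟨m, rfl⟩ := hodd
  set F := (Finset.range (2 * m + 2)).image a with hF
  have hFc : F.card ≤ 2 * m + 2 := Finset.card_image_le.trans (by simp)
  obtain ⟨g, hg⟩ : ∃ g, k = m + g + 2 := ⟨k - m - 2, by lia⟩
  have hne : a 0 ≠ a (2 * m + 1) := fun he => by
    have := hinj (show 0 ∈ Set.Iic (2 * m + 1) by simp) (show 2 * m + 1 ∈ Set.Iic (2 * m + 1) by simp) he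
    lia
  have hj := h.jump g (a 0) (a (2 * m + 1)) F hne (by lia) (by lia)
  have hp1 := ha.path_segment hinj (show 1 ≤ 2 * m + 1 by lia) le_rfl
  have hp2 := hp1.append hj.symm (by
    rintro v ⟨i, hi, rfl⟩ (h1 | h1 | h1)
    · have := hinj (show i ∈ Set.Iic (2 * m + 1) from hi.2) (show 0 ∈ Set.Iic (2 * m + 1) by simp) h1
      have := hi.1
      lia
    · exact h1
    · refine absurd (Finset.mem_image_of_mem a ?_) h1
      have := hi.2
      simp only [Finset.mem_range]
      lia)
  refine h.not_path (a 1) (a 0) (ha 0 (by lia)).symm ?_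
  rw [show 2 * k - 2 = 2 * m + 1 - 1 + 2 * (g + 1) by lia]
  exact hp2.mono (Set.subset_univ _)

end Jump

section Counting

/-- The second Bonferroni inequality, doubled: `2 * ∑ |Z i| ≤ 2 * |V| + ∑_{i ≠ j} |Z i ∩ Z j|`. -/
lemma two_mul_sum_card_le {V ι : Type*} [Fintype V] [DecidableEq V] [DecidableEq ι] (I : Finset ι)
    (Z : ι → Finset V) :
    2 * ∑ i ∈ I, (Z i).card ≤
      2 * Fintype.card V + ∑ p ∈ I.offDiag, (Z p.1 ∩ Z p.2).card := by
  have h1 : ∑ i ∈ I, (Z i).card = ∑ v : V, (I.filter fun i => v ∈ Z i).card := by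
    simp only [Finset.card_eq_sum_ones, Finset.sum_filter]
    rw [Finset.sum_comm]
    refine Finset.sum_congr rfl fun i _ => ?_
    simp
  have h2 : ∑ p ∈ I.offDiag, (Z p.1 ∩ Z p.2).card =
      ∑ v : V, (I.filter fun i => v ∈ Z i).offDiag.card := by
    have : ∀ v : V, (I.filter fun i => v ∈ Z i).offDiag =
        I.offDiag.filter fun p => v ∈ Z p.1 ∩ Z p.2 := by
      intro v
      ext ⟨i, j⟩
      simp only [Finset.mem_offDiag, Finset.mem_filter, Finset.mem_inter]
      tauto
    simp only [this]
    simp only [Finset.card_eq_sum_ones, Finset.sum_filter]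
    rw [Finset.sum_comm]
    refine Finset.sum_congr rfl fun i _ => ?_
    rw [← Finset.sum_filter, ← Finset.card_eq_sum_ones, ← Finset.card_eq_sum_ones,
      Finset.filter_univ_mem]
  rw [h1, h2, Finset.mul_sum, ← Finset.card_univ, Finset.card_eq_sum_ones, Finset.mul_sum,
    ← Finset.sum_add_distrib]
  refine Finset.sum_le_sum fun v _ => ?_
  rw [Finset.offDiag_card]
  generalize (I.filter fun i => v ∈ Z i).card = d
  rcases d with _ | _ | d
  · lia
  · lia
  · have : (d + 1 + 1) * (d + 1 + 1) - (d + 1 + 1) = (d + 2) * (d + 1) :=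
      Nat.sub_eq_of_eq_add (by ring)
    rw [this]
    nlinarith

/-- A `c`-colouring of `V` which colours many of the given `c`-tuples with the colours of their
positions. -/
lemma exists_labelling {V ι : Type*} [Fintype V] [DecidableEq V] (I : Finset ι) {c : ℕ}
    (hc : 0 < c) (e : ι → Fin c → V) (he : ∀ i ∈ I, Function.Injective (e i)) :
    ∃ f : V → Fin c, I.card ≤ (I.filter fun i => ∀ m, f (e i m) = m).card * c ^ c := by
  have : Nonempty (V → Fin c) := ⟨fun _ => ⟨0, hc⟩⟩
  have hgood : ∀ i ∈ I, Fintype.card (V → Fin c) ≤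
      (Finset.univ.filter fun f : V → Fin c => ∀ m, f (e i m) = m).card * c ^ c := by
    intro i hi
    rw [show c ^ c = (Finset.univ : Finset (Fin c → Fin c)).card by simp, ← Finset.card_product,
      ← Finset.card_univ]
    refine Finset.card_le_card_of_injOn (fun f => (Function.extend (e i) id f, f ∘ e i)) ?_ ?_
    · intro f _
      simp [(he i hi).extend_apply]
    · intro f _ g _ hfg
      simp only [Prod.mk.injEq] at hfg
      funext v
      by_cases hv : ∃ m, e i m = v
      · obtain ⟨m, rfl⟩ := hv
        exact congrFun hfg.2 m
      · have := congrFun hfg.1 v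
        rwa [Function.extend_apply' _ _ _ hv, Function.extend_apply' _ _ _ hv] at this
  have hsum : ∑ f : V → Fin c, (I.filter fun i => ∀ m, f (e i m) = m).card =
      ∑ i ∈ I, (Finset.univ.filter fun f : V → Fin c => ∀ m, f (e i m) = m).card := by
    simp only [Finset.card_eq_sum_ones, Finset.sum_filter]
    rw [Finset.sum_comm]
  by_contra! hcon
  have h1 : ∑ f : V → Fin c, (I.filter fun i => ∀ m, f (e i m) = m).card * c ^ c <
      ∑ _f : V → Fin c, I.card :=
    Finset.sum_lt_sum_of_nonempty Finset.univ_nonempty fun f _ => hcon f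
  rw [← Finset.sum_mul, hsum, Finset.sum_const, Finset.card_univ, smul_eq_mul,
    Finset.sum_mul] at h1
  have h2 := Finset.sum_le_sum hgood
  rw [Finset.sum_const, smul_eq_mul] at h2
  rw [mul_comm] at h2
  exact absurd (h2.trans_lt h1) (lt_irrefl _)

end Counting

section Copattern

variable {V : Type*} [Fintype V] [DecidableEq V] {G : SimpleGraph V} {k q A K : ℕ}

/-- A path with `2 * k - 1` vertices has two vertices with many common neighbours, and they are at
an even distance on the path. -/
lemma DenseMaximal.exists_even (h : DenseMaximal G k q A K) {x : ℕ → V}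
    (hx : IsWalkSeq G (2 * k - 2) x) (hinj : Set.InjOn x (Set.Iic (2 * k - 2))) :
    ∃ s t, s < t ∧ t ≤ 2 * k - 2 ∧ Even (t - s) ∧ 4 * q ≤ cod G (x s) (x t) := by
  have hk := h.three_le
  have hKq := h.K_le
  have hex : ∃ s t, s < t ∧ t ≤ 2 * k - 2 ∧ 4 * q ≤ cod G (x s) (x t) := by
    obtain ⟨u, hu, v, hv, huv, hc⟩ := h.pigeon ((Finset.range (2 * k - 1)).image x) (by
      rw [Finset.card_image_of_injOn, Finset.card_range]
      exact hinj.mono (fun i hi => by simp at hi ⊢; lia))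
    simp only [Finset.mem_image, Finset.mem_range] at hu hv
    obtain ⟨s, hs, rfl⟩ := hu
    obtain ⟨t, ht, rfl⟩ := hv
    rcases lt_trichotomy s t with hst | rfl | hst
    · exact ⟨s, t, hst, by lia, hc⟩
    · exact absurd rfl huv
    · exact ⟨t, s, hst, by lia, by rwa [cod_comm]⟩
  obtain ⟨s, t, hst, ht, hc⟩ := hex
  refine ⟨s, t, hst, ht, ?_, hc⟩
  by_contra hodd
  rw [Nat.not_even_iff_odd] at hodd
  have hp := hx.path_segment hinj hst.le ht
  refine h.no_odd_path (by lia) hp hodd ?_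
  obtain ⟨m, hm⟩ := hodd
  lia

/-- There is no long half-graph-like sequence of non-adjacent pairs. -/
lemma DenseMaximal.no_copattern (h : DenseMaximal G k q A K) {p : ℕ}
    (hp : p = A * (2 * k - 1) ^ 2 * (2 * k - 1) ^ (2 * k - 1)) (a b : ℕ → V)
    (hne : ∀ i < p, a i ≠ b i ∧ ¬ G.Adj (a i) (b i))
    (hadj : ∀ i j, i < j → j < p → G.Adj (b i) (a j)) : False := by
  have hk := h.three_le
  have hA := h.one_le_A
  have hKq := h.K_le
  have hpath : ∀ i, ∃ x : ℕ → V, i < p → IsWalkSeq G (2 * k - 2) x ∧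
      Set.InjOn x (Set.Iic (2 * k - 2)) ∧ x 0 = a i ∧ x (2 * k - 2) = b i := by
    intro i
    by_cases hi : i < p
    · obtain ⟨x, h1, h2, h3, h4, -⟩ := h.path _ _ (hne i hi).1 (hne i hi).2
      exact ⟨x, fun _ => ⟨h1, h2, h3, h4⟩⟩
    · exact ⟨fun _ => a 0, fun h => absurd h hi⟩
  choose x hx using hpath
  obtain ⟨f, hf⟩ := exists_labelling (Finset.range p) (show 0 < 2 * k - 1 by lia)
    (fun i (m : Fin (2 * k - 1)) => x i m) (by
      intro i hi m m' hmm
      have h1 := m.2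
      have h2 := m'.2
      exact Fin.ext ((hx i (Finset.mem_range.1 hi)).2.1 (show (m : ℕ) ≤ 2 * k - 2 by lia)
        (show (m' : ℕ) ≤ 2 * k - 2 by lia) hmm))
  set J := (Finset.range p).filter fun i => ∀ m : Fin (2 * k - 1), f (x i m) = m with hJ
  have hJc : A * (2 * k - 1) ^ 2 ≤ J.card := by
    rw [Finset.card_range, hp] at hf
    exact Nat.le_of_mul_le_mul_right hf (Nat.pow_pos (by lia))
  have hJp : ∀ i ∈ J, i < p := fun i hi => Finset.mem_range.1 (Finset.mem_filter.1 hi).1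
  have hlab : ∀ i ∈ J, ∀ m ≤ 2 * k - 2, (f (x i m) : ℕ) = m := by
    intro i hi m hm
    have := (Finset.mem_filter.1 hi).2 ⟨m, by lia⟩
    simpa using congrArg Fin.val this
  have hpair : ∀ i, ∃ st : ℕ × ℕ, i ∈ J → st.1 < st.2 ∧ st.2 ≤ 2 * k - 2 ∧ Even (st.2 - st.1) ∧
      4 * q ≤ cod G (x i st.1) (x i st.2) := by
    intro i
    by_cases hi : i ∈ J
    · obtain ⟨s, t, h1⟩ := h.exists_even (hx i (hJp i hi)).1 (hx i (hJp i hi)).2.1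
      exact ⟨(s, t), fun _ => h1⟩
    · exact ⟨(0, 0), fun h => absurd h hi⟩
  choose st hst using hpair
  obtain ⟨⟨s, t⟩, hmem, hfib⟩ := Finset.exists_le_card_fiber_of_mul_le_card_of_maps_to
    (s := J) (t := Finset.range (2 * k - 1) ×ˢ Finset.range (2 * k - 1)) (f := st) (n := A)
    (fun i hi => by
      have := hst i hi
      simp only [Finset.mem_product, Finset.mem_range]
      lia)
    ⟨(0, 0), by simp; lia⟩ (by
      rw [Finset.card_product, Finset.card_range]
      calc _ = A * (2 * k - 1) ^ 2 := by ring
        _ ≤ _ := hJc)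
  obtain ⟨I, hI, hIc⟩ := Finset.exists_subset_card_eq hfib
  have hIJ : ∀ i ∈ I, i ∈ J ∧ st i = (s, t) := fun i hi => Finset.mem_filter.1 (hI hi)
  have hIst : ∀ i ∈ I, s < t ∧ t ≤ 2 * k - 2 ∧ Even (t - s) ∧ 4 * q ≤ cod G (x i s) (x i t) := by
    intro i hi
    have := hst i (hIJ i hi).1
    rwa [(hIJ i hi).2] at this
  have hover : ∃ i ∈ I, ∃ j ∈ I, i < j ∧ K ≤ cod G (x i t) (x j s) := by
    by_contra! hcon
    have hb := two_mul_sum_card_le I (fun i => nbr G (x i s) ∩ nbr G (x i t))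
    have h1 : I.card * (4 * q) ≤ ∑ i ∈ I, (nbr G (x i s) ∩ nbr G (x i t)).card := by
      rw [← smul_eq_mul]
      exact Finset.card_nsmul_le_sum _ _ _ fun i hi => (hIst i hi).2.2.2
    have h2 : ∑ p ∈ I.offDiag, ((nbr G (x p.1 s) ∩ nbr G (x p.1 t)) ∩
        (nbr G (x p.2 s) ∩ nbr G (x p.2 t))).card ≤ I.offDiag.card * K := by
      rw [← smul_eq_mul]
      refine Finset.sum_le_card_nsmul _ _ _ ?_
      rintro ⟨i, j⟩ hij
      rw [Finset.mem_offDiag] at hij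
      obtain ⟨hi, hj, hij⟩ := hij
      rcases lt_or_gt_of_ne hij with hlt | hlt
      · refine le_trans (Finset.card_le_card ?_) (hcon i hi j hj hlt).le
        intro v hv
        simp only [Finset.mem_inter] at hv ⊢
        exact ⟨hv.1.2, hv.2.1⟩
      · refine le_trans (Finset.card_le_card ?_) (hcon j hj i hi hlt).le
        intro v hv
        simp only [Finset.mem_inter] at hv ⊢
        exact ⟨hv.2.2, hv.1.1⟩
    have h3 : I.offDiag.card * K ≤ A * q := by
      rw [Finset.offDiag_card, hIc]
      calc (A * A - A) * K ≤ A * A * K := Nat.mul_le_mul_right _ (Nat.sub_le _ _)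
        _ = A * (A * K) := by ring
        _ ≤ A * q := Nat.mul_le_mul_left _ h.mul_le
    rw [hIc] at h1
    have h4 := h.card_le
    have h5 : 0 < A * q := Nat.mul_pos hA (by have := h.le_K; lia)
    nlinarith
  obtain ⟨i, hi, j, hj, hij, hc⟩ := hover
  obtain ⟨hst', ht, heven, -⟩ := hIst i hi
  have hiJ := (hIJ i hi).1
  have hjJ := (hIJ j hj).1
  obtain ⟨hxi, hxi', hxi0, hxi1⟩ := hx i (hJp i hiJ)
  obtain ⟨hxj, hxj', hxj0, hxj1⟩ := hx j (hJp j hjJ)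
  have hp1 := hxi.path_segment hxi' ht le_rfl
  have hp2 := hxj.path_segment hxj' (Nat.zero_le s) (by lia)
  rw [hxi1] at hp1
  rw [hxj0] at hp2
  have hdisj : ∀ m ≤ 2 * k - 2, t ≤ m → x i m ∉ x j '' Set.Icc 0 s := by
    rintro m hm htm ⟨m', hm', he⟩
    have h1 := hlab i hiJ m hm
    have h2 := hlab j hjJ m' (by have := hm'.2; lia)
    rw [he, h1] at h2
    have := hm'.2
    lia
  have hp3 := hp2.cons (hadj i j hij (hJp j hjJ)) (by
    rw [← hxi1]
    exact hdisj _ le_rfl ht)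
  have hp4 := hp1.append hp3 (by
    rintro v ⟨m, hm, rfl⟩ hv
    rcases hv with hv | hv
    · exact hv
    · exact absurd hv (hdisj m hm.2 hm.1))
  obtain ⟨g, hg⟩ := heven
  exact h.no_odd_path hc hp4 ⟨k - 1 - g, by lia⟩ (by lia)

end Copattern

section Classes

/-- The number of vertices adjacent to exactly one of `x` and `y`. -/
noncomputable def nbrDist {V : Type*} [Fintype V] [DecidableEq V] (G : SimpleGraph V)
    (x y : V) : ℕ :=
  (nbr G x \ nbr G y).card + (nbr G y \ nbr G x).card

variable {V : Type*} [Fintype V] [DecidableEq V] {G : SimpleGraph V} {k q A K : ℕ}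

lemma nbrDist_comm (x y : V) : nbrDist G x y = nbrDist G y x := add_comm _ _

lemma nbrDist_self (x : V) : nbrDist G x x = 0 := by simp [nbrDist]

lemma nbrDist_triangle (x y z : V) : nbrDist G x z ≤ nbrDist G x y + nbrDist G y z := by
  have key : ∀ a b c : Finset V, (a \ c).card ≤ (a \ b).card + (b \ c).card := by
    intro a b c
    refine (Finset.card_le_card (t := (a \ b) ∪ (b \ c)) ?_).trans (Finset.card_union_le _ _)
    intro v hv
    simp only [Finset.mem_sdiff, Finset.mem_union] at hv ⊢
    tauto
  have h1 := key (nbr G x) (nbr G y) (nbr G z)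
  have h2 := key (nbr G z) (nbr G y) (nbr G x)
  simp only [nbrDist]
  lia

lemma cod_le_add_nbrDist (x y w : V) : cod G x w ≤ cod G y w + nbrDist G x y := by
  have : cod G x w ≤ cod G y w + (nbr G x \ nbr G y).card := by
    refine (Finset.card_le_card (t := (nbr G y ∩ nbr G w) ∪ (nbr G x \ nbr G y)) ?_).trans
      (Finset.card_union_le _ _)
    intro v hv
    simp only [Finset.mem_sdiff, Finset.mem_union, Finset.mem_inter] at hv ⊢
    tauto
  simp only [nbrDist]
  lia

lemma card_nbr_le (x y : V) : (nbr G x).card ≤ cod G x y + nbrDist G x y := by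
  have := Finset.card_inter_add_card_sdiff (nbr G x) (nbr G y)
  simp only [nbrDist, cod]
  lia

open Classical in
lemma sum_nbrDist_le (X : Finset V) :
    ∑ p ∈ X.offDiag, nbrDist G p.1 p.2 ≤
      ∑ b : V, 2 * ((X.filter fun x => G.Adj b x).card * (X.filter fun x => ¬ G.Adj b x).card) := by
  have h1 : ∀ b : V, (X.filter fun x => G.Adj b x).card * (X.filter fun x => ¬ G.Adj b x).card =
      ∑ p ∈ X ×ˢ X, if G.Adj b p.1 ∧ ¬ G.Adj b p.2 then 1 else 0 := by
    intro b
    rw [← Finset.card_product, ← Finset.filter_product, Finset.card_eq_sum_ones,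
      Finset.sum_filter]
  have h2 : ∀ p : V × V, (nbr G p.1 \ nbr G p.2).card =
      ∑ b : V, if G.Adj b p.1 ∧ ¬ G.Adj b p.2 then 1 else 0 := by
    intro p
    rw [← Finset.sum_filter, ← Finset.card_eq_sum_ones]
    congr 1
    ext b
    simp [G.adj_comm]
  have h3 : ∑ p ∈ X.offDiag, (nbr G p.2 \ nbr G p.1).card =
      ∑ p ∈ X.offDiag, (nbr G p.1 \ nbr G p.2).card := by
    refine Finset.sum_nbij' Prod.swap Prod.swap ?_ ?_ ?_ ?_ ?_
    · rintro ⟨x, y⟩ hp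
      simp only [Finset.mem_offDiag, Prod.swap] at hp ⊢
      tauto
    · rintro ⟨x, y⟩ hp
      simp only [Finset.mem_offDiag, Prod.swap] at hp ⊢
      tauto
    · simp
    · simp
    · simp
  simp only [nbrDist]
  rw [Finset.sum_add_distrib, h3, ← two_mul, ← Finset.mul_sum]
  refine Nat.mul_le_mul_left _ ?_
  simp only [h1]
  rw [Finset.sum_comm]
  simp only [h2]
  refine Finset.sum_le_sum_of_subset ?_
  intro p hp
  rw [Finset.mem_offDiag] at hp
  simp [hp.1, hp.2.1]

open Classical in
/-- A large set of vertices with pairwise different neighbourhoods contains a long copattern. -/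
lemma DenseMaximal.exists_copattern (h : DenseMaximal G k q A K) (p : ℕ) :
    ∀ X : Finset V, (4 * A) ^ p ≤ X.card → (∀ x ∈ X, ∀ y ∈ X, x ≠ y → q ≤ nbrDist G x y) →
      ∃ a b : ℕ → V, (∀ i < p, a i ∈ X ∧ a i ≠ b i ∧ ¬ G.Adj (a i) (b i)) ∧
        ∀ i j, i < j → j < p → G.Adj (b i) (a j) := by
  have hA := h.one_le_A
  have hk := h.three_le
  have hq : 0 < q := by have := h.K_le; have := h.le_K; lia
  induction p with
  | zero =>
    intro X hX _
    obtain ⟨x, -⟩ := Finset.card_pos.1 (show 0 < X.card by simpa using hX)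
    exact ⟨fun _ => x, fun _ => x, by simp, by simp⟩
  | succ p ih =>
    intro X hX hsep
    have hX4 : 4 * A * (4 * A) ^ p ≤ X.card := by rwa [pow_succ, mul_comm] at hX
    have hpow : 1 ≤ (4 * A) ^ p := Nat.one_le_pow _ _ (by lia)
    have hXA : 4 * A ≤ X.card := (Nat.le_mul_of_pos_right _ hpow).trans hX4
    have hne : (Finset.univ : Finset V).Nonempty := by
      obtain ⟨x, -⟩ := Finset.card_pos.1 (show 0 < X.card by lia)
      exact ⟨x, Finset.mem_univ _⟩
    have hb : ∃ b : V, X.card * (X.card - 1) ≤ A * ((X.filter fun x => G.Adj b x).card *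
        (X.filter fun x => ¬ G.Adj b x).card) := by
      by_contra! hcon
      have h1 := sum_nbrDist_le (G := G) X
      have h2 : X.offDiag.card * q ≤ ∑ p ∈ X.offDiag, nbrDist G p.1 p.2 := by
        rw [← smul_eq_mul]
        refine Finset.card_nsmul_le_sum _ _ _ fun p hp => ?_
        rw [Finset.mem_offDiag] at hp
        exact hsep _ hp.1 _ hp.2.1 hp.2.2
      have h3 := Finset.sum_lt_sum_of_nonempty hne fun b _ => hcon b
      rw [Finset.sum_const, Finset.card_univ, smul_eq_mul, ← Finset.mul_sum] at h3
      rw [← Finset.mul_sum] at h1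
      have h4 : X.offDiag.card = X.card * (X.card - 1) := by
        rw [Finset.offDiag_card, Nat.mul_sub, mul_one]
      rw [h4] at h2
      have h5 := Nat.mul_le_mul_right (X.card * (X.card - 1)) h.card_le
      have h6 := Nat.mul_le_mul_left A (h2.trans h1)
      nlinarith
    obtain ⟨b, hb⟩ := hb
    have hsum : (X.filter fun x => G.Adj b x).card + (X.filter fun x => ¬ G.Adj b x).card =
        X.card := Finset.card_filter_add_card_filter_not _
    have hb1 : X.card - 1 ≤ A * (X.filter fun x => G.Adj b x).card := by
      refine Nat.le_of_mul_le_mul_left (hb.trans ?_) (show 0 < X.card by lia)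
      calc _ = (X.filter fun x => ¬ G.Adj b x).card * (A * (X.filter fun x => G.Adj b x).card) := by
            ring
        _ ≤ _ := Nat.mul_le_mul_right _ (by lia)
    have hb2 : X.card - 1 ≤ A * (X.filter fun x => ¬ G.Adj b x).card := by
      refine Nat.le_of_mul_le_mul_left (hb.trans ?_) (show 0 < X.card by lia)
      calc _ = (X.filter fun x => G.Adj b x).card * (A * (X.filter fun x => ¬ G.Adj b x).card) := by
            ring
        _ ≤ _ := Nat.mul_le_mul_right _ (by lia)
    have hXb : (4 * A) ^ p ≤ (X.filter fun x => G.Adj b x).card := by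
      by_contra! hlt
      have h1 := Nat.mul_le_mul_left A hlt.le
      have h2 : 0 < A * (4 * A) ^ p := Nat.mul_pos hA hpow
      have h3 : 4 * A * (4 * A) ^ p = 4 * (A * (4 * A) ^ p) := by ring
      lia
    have hXb' : 1 < (X.filter fun x => ¬ G.Adj b x).card := by
      by_contra! hlt
      have h1 := Nat.mul_le_mul_left A hlt
      lia
    obtain ⟨a₀, ha₀, hne₀⟩ := Finset.exists_mem_ne hXb' b
    rw [Finset.mem_filter] at ha₀
    obtain ⟨a, b', h1, h2⟩ := ih _ hXb fun x hx y hy =>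
      hsep x (Finset.mem_filter.1 hx).1 y (Finset.mem_filter.1 hy).1
    refine ⟨fun i => if i = 0 then a₀ else a (i - 1), fun i => if i = 0 then b else b' (i - 1),
      ?_, ?_⟩
    · intro i hi
      by_cases hi0 : i = 0
      · simp only [hi0, if_true]
        exact ⟨ha₀.1, hne₀, fun h => ha₀.2 h.symm⟩
      · simp only [hi0, if_false]
        obtain ⟨g1, g2⟩ := h1 (i - 1) (by lia)
        exact ⟨(Finset.mem_filter.1 g1).1, g2⟩
    · intro i j hij hj
      have hj0 : j ≠ 0 := by lia
      by_cases hi0 : i = 0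
      · simp only [hi0, hj0, if_true, if_false]
        exact (Finset.mem_filter.1 (h1 (j - 1) (by lia)).1).2
      · simp only [hi0, hj0, if_false]
        exact h2 _ _ (by lia) (by lia)

/-- The vertices fall into a bounded number of classes of near twins. -/
lemma DenseMaximal.exists_classes (h : DenseMaximal G k q A K) :
    ∃ cls : V → Fin ((4 * A) ^ (A * (2 * k - 1) ^ 2 * (2 * k - 1) ^ (2 * k - 1))),
      ∀ v w, cls v = cls w → nbrDist G v w < 2 * q := by
  classical
  have hq : 0 < q := by have := h.K_le; have := h.le_K; have := h.three_le; lia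
  set R := (4 * A) ^ (A * (2 * k - 1) ^ 2 * (2 * k - 1) ^ (2 * k - 1)) with hR
  obtain ⟨X, hX, hmax⟩ := Finset.exists_max_image ((Finset.univ : Finset (Finset V)).filter
    fun X => ∀ x ∈ X, ∀ y ∈ X, x ≠ y → q ≤ nbrDist G x y) Finset.card ⟨∅, by simp⟩
  rw [Finset.mem_filter] at hX
  have hXR : X.card ≤ R := by
    by_contra! hlt
    obtain ⟨a, b, h1, h2⟩ := h.exists_copattern _ X hlt.le hX.2
    exact h.no_copattern rfl a b (fun i hi => (h1 i hi).2) h2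
  have hcov : ∀ v, ∃ x : X, nbrDist G v x < q := by
    intro v
    by_cases hv : v ∈ X
    · exact ⟨⟨v, hv⟩, by simpa [nbrDist_self] using hq⟩
    · by_contra! hcon
      have := hmax (insert v X) (by
        simp only [Finset.mem_filter, Finset.mem_univ, true_and, Finset.mem_insert]
        rintro x (rfl | hx) y (rfl | hy) hxy
        · exact absurd rfl hxy
        · exact hcon ⟨y, hy⟩
        · rw [nbrDist_comm]
          exact hcon ⟨x, hx⟩
        · exact hX.2 x hx y hy hxy)
      rw [Finset.card_insert_of_notMem hv] at this
      lia
  choose c hc using hcov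
  refine ⟨fun v => Fin.castLE hXR (X.equivFin (c v)), fun v w hvw => ?_⟩
  have hcc : c v = c w := X.equivFin.injective (Fin.castLE_injective hXR hvw)
  have h1 := hc v
  have h2 := hc w
  rw [← hcc, nbrDist_comm] at h2
  have := nbrDist_triangle (G := G) v (c v) w
  lia

end Classes

/-- `c 0, …, c (ℓ - 1)` is a cycle in `G`, and `c ℓ = c 0`. -/
def IsCycleSeq {V : Type*} (G : SimpleGraph V) (ℓ : ℕ) (c : ℕ → V) : Prop :=
  IsWalkSeq G ℓ c ∧ Set.InjOn c (Set.Iio ℓ) ∧ c ℓ = c 0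

section OddCycles

variable {V : Type*} {G : SimpleGraph V} {S : Set V}

/-- An odd walk contains an odd path with the same ends or an odd cycle. -/
lemma HasWalk.exists_odd_path_or_cycle (L : ℕ) : ∀ {a b : V}, HasWalk G S L a b → Odd L →
    (∃ L' ≤ L, Odd L' ∧ HasPath G S L' a b) ∨
      ∃ ℓ ≤ L, Odd ℓ ∧ ∃ c, IsCycleSeq G ℓ c ∧ ∀ i ≤ ℓ, c i ∈ S := by
  induction L using Nat.strong_induction_on with
  | _ L ih =>
  intro a b hw hodd
  obtain ⟨x, hx, rfl, rfl, hxS⟩ := hw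
  by_cases h1 : ∃ i j, i < j ∧ j ≤ L ∧ x i = x j ∧ Even (j - i)
  · obtain ⟨i, j, hij, hj, he, m, hm⟩ := h1
    have hsub : ∀ i' j', j' ≤ L → x '' Set.Icc i' j' ⊆ S := by
      rintro i' j' hj' _ ⟨m, hm, rfl⟩
      exact hxS m (hm.2.trans hj')
    have w1 := (hx.segment (Nat.zero_le i) (by lia)).mono (hsub _ _ (by lia))
    have w2 := (hx.segment hj le_rfl).mono (hsub _ _ le_rfl)
    rw [he] at w1
    obtain ⟨n, hn⟩ := hodd
    have hlen : i - 0 + (L - j) = 2 * (n - m) + 1 := by lia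
    rcases ih _ (by lia) (w1.append w2) ⟨_, hlen⟩ with ⟨L', g1, g2⟩ | ⟨ℓ, g1, g2⟩
    · exact Or.inl ⟨L', by lia, g2⟩
    · exact Or.inr ⟨ℓ, by lia, g2⟩
  by_cases h2 : ∃ i j, i < j ∧ j ≤ L ∧ x i = x j ∧ j - i < L
  · obtain ⟨i, j, hij, hj, he, hlt⟩ := h2
    have w1 := (hx.segment hij.le hj).mono (show x '' Set.Icc i j ⊆ S by
      rintro _ ⟨m, hm, rfl⟩
      exact hxS m (hm.2.trans hj))
    have hodd' : Odd (j - i) := by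
      rw [← Nat.not_even_iff_odd]
      exact fun h => h1 ⟨i, j, hij, hj, he, h⟩
    rw [← he] at w1
    rcases ih _ hlt w1 hodd' with ⟨L', g1, g2, y, -, g3, g4, g5, -⟩ | ⟨ℓ, g1, g2⟩
    · have := g3 (show 0 ∈ Set.Iic L' by simp) (show L' ∈ Set.Iic L' by simp) (g4.trans g5.symm)
      obtain ⟨m, hm⟩ := g2
      lia
    · exact Or.inr ⟨ℓ, by lia, g2⟩
  by_cases h3 : x 0 = x L
  · refine Or.inr ⟨L, le_rfl, hodd, x, ⟨hx, ?_, h3.symm⟩, hxS⟩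
    intro i hi j hj hij
    simp only [Set.mem_Iio] at hi hj
    rcases lt_trichotomy i j with h | h | h
    · exact absurd ⟨i, j, h, hj.le, hij, by lia⟩ h2
    · exact h
    · exact absurd ⟨j, i, h, hi.le, hij.symm, by lia⟩ h2
  · refine Or.inl ⟨L, le_rfl, hodd, x, hx, ?_, rfl, rfl, hxS⟩
    have key : ∀ i j, i < j → j ≤ L → x i ≠ x j := by
      intro i j hij hj he
      by_cases hL : j - i < L
      · exact h2 ⟨i, j, hij, hj, he, hL⟩
      · obtain rfl : i = 0 := by lia
        obtain rfl : j = L := by lia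
        exact h3 he
    intro i hi j hj hij
    rcases lt_trichotomy i j with h | h | h
    · exact absurd hij (key i j h hj)
    · exact h
    · exact absurd hij.symm (key j i h hi)

lemma IsCycleSeq.path_of_lt {ℓ : ℕ} {c : ℕ → V} (hc : IsCycleSeq G ℓ c) {s t : ℕ} (hst : s < t)
    (ht : t < ℓ) : HasPath G (c '' Set.Iio ℓ) (t - s) (c s) (c t) := by
  refine ⟨fun m => c (s + m), fun m hm => hc.1 (s + m) (by lia), fun m hm m' hm' h => ?_, rfl,
    by simp [hst.le], fun m hm => ⟨s + m, by simp; lia, rfl⟩⟩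
  simp only [Set.mem_Iic] at hm hm'
  have := hc.2.1 (show s + m ∈ Set.Iio ℓ by simp; lia) (show s + m' ∈ Set.Iio ℓ by simp; lia) h
  lia

lemma IsCycleSeq.path_around {ℓ : ℕ} {c : ℕ → V} (hc : IsCycleSeq G ℓ c) {s t : ℕ} (hst : s < t)
    (ht : t < ℓ) : HasPath G (c '' Set.Iio ℓ) (ℓ - (t - s)) (c t) (c s) := by
  refine ⟨fun m => if t + m < ℓ then c (t + m) else c (t + m - ℓ), fun m hm => ?_,
    fun m hm m' hm' h => ?_, ?_, ?_, fun m hm => ?_⟩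
  · dsimp only
    rcases lt_trichotomy (t + m + 1) ℓ with h | h | h
    · rw [if_pos (by lia), if_pos (by lia)]
      exact hc.1 (t + m) (by lia)
    · rw [if_pos (by lia), if_neg (by lia), show t + (m + 1) - ℓ = 0 by lia, ← hc.2.2]
      have := hc.1 (t + m) (by lia)
      rwa [h] at this
    · rw [if_neg (by lia), if_neg (by lia), show t + (m + 1) - ℓ = t + m - ℓ + 1 by lia]
      exact hc.1 _ (by lia)
  · simp only [Set.mem_Iic] at hm hm'
    dsimp only at h
    split_ifs at h with h1 h2 h2
    · have := hc.2.1 (show t + m ∈ Set.Iio ℓ from h1) (show t + m' ∈ Set.Iio ℓ from h2) h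
      lia
    · have := hc.2.1 (show t + m ∈ Set.Iio ℓ from h1)
        (show t + m' - ℓ ∈ Set.Iio ℓ by simp; lia) h
      lia
    · have := hc.2.1 (show t + m - ℓ ∈ Set.Iio ℓ by simp; lia)
        (show t + m' ∈ Set.Iio ℓ from h2) h
      lia
    · have := hc.2.1 (show t + m - ℓ ∈ Set.Iio ℓ by simp; lia)
        (show t + m' - ℓ ∈ Set.Iio ℓ by simp; lia) h
      lia
  · simp [ht]
  · dsimp only
    rw [if_neg (by lia), show t + (ℓ - (t - s)) - ℓ = s by lia]
  · dsimp only
    split_ifs with h1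
    · exact ⟨_, h1, rfl⟩
    · exact ⟨t + m - ℓ, by simp; lia, rfl⟩

/-- Two vertices of an odd cycle are joined by an odd arc of the cycle. -/
lemma IsCycleSeq.odd_arc {ℓ : ℕ} {c : ℕ → V} (hc : IsCycleSeq G ℓ c) (hℓ : Odd ℓ) {s t : ℕ}
    (hs : s < ℓ) (ht : t < ℓ) (hst : s ≠ t) :
    ∃ L, Odd L ∧ L + 2 ≤ ℓ ∧ HasPath G (c '' Set.Iio ℓ) L (c s) (c t) := by
  wlog hlt : s < t generalizing s t
  · obtain ⟨L, h1, h2, h3⟩ := this ht hs hst.symm (by lia)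
    exact ⟨L, h1, h2, h3.symm⟩
  obtain ⟨n, hn⟩ := hℓ
  rcases Nat.even_or_odd (t - s) with ⟨m, hm⟩ | ⟨m, hm⟩
  · exact ⟨_, ⟨n - m, by lia⟩, by lia, (hc.path_around hlt ht).symm⟩
  · exact ⟨_, ⟨m, hm⟩, by lia, hc.path_of_lt hlt ht⟩

/-- Two vertices of an odd cycle are joined by an even arc of the cycle. -/
lemma IsCycleSeq.even_arc {ℓ : ℕ} {c : ℕ → V} (hc : IsCycleSeq G ℓ c) (hℓ : Odd ℓ) {s t : ℕ}
    (hs : s < ℓ) (ht : t < ℓ) :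
    ∃ L, Even L ∧ L + 1 ≤ ℓ ∧ HasPath G (c '' Set.Iio ℓ) L (c s) (c t) := by
  by_cases hst : s = t
  · subst hst
    exact ⟨0, by simp, by lia, HasPath.refl ⟨s, hs, rfl⟩⟩
  wlog hlt : s < t generalizing s t
  · obtain ⟨L, h1, h2, h3⟩ := this ht hs (Ne.symm hst) (by lia)
    exact ⟨L, h1, h2, h3.symm⟩
  obtain ⟨n, hn⟩ := hℓ
  rcases Nat.even_or_odd (t - s) with ⟨m, hm⟩ | ⟨m, hm⟩
  · exact ⟨_, ⟨m, hm⟩, by lia, hc.path_of_lt hlt ht⟩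
  · exact ⟨_, ⟨n - m, by lia⟩, by lia, (hc.path_around hlt ht).symm⟩

lemma exists_hitting_or_disjoint [DecidableEq V] (G : SimpleGraph V) (k m : ℕ) :
    (∃ B : Finset V, B.card ≤ 2 * k * m ∧ ∀ ℓ c, Odd ℓ → ℓ ≤ 2 * k - 3 → IsCycleSeq G ℓ c →
      ∃ i < ℓ, c i ∈ B) ∨
    ∃ (l : ℕ → ℕ) (c : ℕ → ℕ → V), (∀ i < m, Odd (l i) ∧ l i ≤ 2 * k - 3 ∧
      IsCycleSeq G (l i) (c i)) ∧ ∀ i j, i < j → j < m → ∀ s < l i, ∀ t < l j, c i s ≠ c j t := by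
  induction m with
  | zero =>
    by_cases hV : Nonempty V
    · obtain ⟨v⟩ := hV
      exact Or.inr ⟨fun _ => 0, fun _ _ => v, by simp, by simp⟩
    · exact Or.inl ⟨∅, by simp, fun ℓ c => absurd ⟨c 0⟩ hV⟩
  | succ m ih =>
    rcases ih with ⟨B, hB, h⟩ | ⟨l, c, h1, h2⟩
    · exact Or.inl ⟨B, hB.trans (Nat.mul_le_mul_left _ (by lia)), h⟩
    set B := (Finset.range m).biUnion fun i => (Finset.range (l i)).image (c i) with hB
    have hBc : B.card ≤ 2 * k * (m + 1) := by
      calc B.card ≤ (Finset.range m).card * (2 * k) := by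
            refine Finset.card_biUnion_le_card_mul _ _ _ fun i hi => ?_
            refine Finset.card_image_le.trans ?_
            have := (h1 i (Finset.mem_range.1 hi)).2.1
            rw [Finset.card_range]
            lia
        _ ≤ _ := by
            rw [Finset.card_range]
            nlinarith
    by_cases hhit : ∀ ℓ c, Odd ℓ → ℓ ≤ 2 * k - 3 → IsCycleSeq G ℓ c → ∃ i < ℓ, c i ∈ B
    · exact Or.inl ⟨B, hBc, hhit⟩
    · push Not at hhit
      obtain ⟨ℓ', c', g1, g2, g3, g4⟩ := hhit
      refine Or.inr ⟨fun i => if i < m then l i else ℓ', fun i => if i < m then c i else c', ?_, ?_⟩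
      · intro i hi
        by_cases him : i < m
        · simpa [him] using h1 i him
        · simpa [him] using ⟨g1, g2, g3⟩
      · intro i j hij hj s hs t ht
        have him : i < m := by lia
        simp only [him, if_true] at hs ⊢
        by_cases hjm : j < m
        · simp only [hjm, if_true] at ht ⊢
          exact h2 i j hij hjm s hs t ht
        · simp only [hjm, if_false] at ht ⊢
          intro he
          refine g4 t ht ?_
          rw [hB, Finset.mem_biUnion]
          exact ⟨i, by simpa using him, Finset.mem_image.2 ⟨s, by simpa using hs, he⟩⟩

end OddCycles

section HittingSet

variable {V : Type*} [Fintype V] [DecidableEq V] {G : SimpleGraph V} {k q A K : ℕ}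

lemma exists_common_nbr {x y : V} {F : Finset V} (h : F.card < cod G x y) :
    ∃ z ∉ F, G.Adj x z ∧ G.Adj y z := by
  obtain ⟨z, hz, hzF⟩ := Finset.exists_mem_notMem_of_card_lt_card (s := F) h
  simp only [Finset.mem_inter, mem_nbr] at hz
  exact ⟨z, hzF, hz⟩

lemma cod_ge_of_nbrDist {x y w : V} {m : ℕ} (h : nbrDist G x y < 2 * m) (hc : 4 * m ≤ cod G x w) :
    2 * m ≤ cod G y w := by
  have := cod_le_add_nbrDist (G := G) x y w
  lia

lemma DenseMaximal.cod_ge_of_nbrDist_lt (h : DenseMaximal G k q A K) {x y : V}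
    (hxy : nbrDist G x y < 2 * q) : 2 * q ≤ cod G x y := by
  have h1 := h.deg x
  have h2 := card_nbr_le (G := G) x y
  lia

/-- There are no two disjoint short odd cycles whose corresponding vertices are near twins. -/
lemma DenseMaximal.no_twin_cycles (h : DenseMaximal G k q A K) {ℓ : ℕ} {c c' : ℕ → V}
    (hc : IsCycleSeq G ℓ c) (hc' : IsCycleSeq G ℓ c') (hodd : Odd ℓ) (hℓ : ℓ ≤ 2 * k - 3)
    (hdisj : ∀ s < ℓ, ∀ t < ℓ, c s ≠ c' t) (htw : ∀ s < ℓ, nbrDist G (c s) (c' s) < 2 * q) :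
    False := by
  have hk := h.three_le
  have hK := h.le_K
  have hKq := h.K_le
  have hℓ1 : ℓ ≠ 1 := by
    rintro rfl
    have := (hc.1 0 (by lia)).ne
    exact this hc.2.2.symm
  obtain ⟨n, hn⟩ := hodd
  have hodd : Odd ℓ := ⟨n, hn⟩
  set C := c '' Set.Iio ℓ with hC
  set F := (Finset.range ℓ).image c with hF
  have hFc : F.card = ℓ := by
    rw [hF, Finset.card_image_of_injOn, Finset.card_range]
    simpa using hc.2.1
  set F' := (Finset.range ℓ).image c' with hF'
  have hFc' : F'.card ≤ ℓ := Finset.card_image_le.trans (by simp)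
  have hmemF : ∀ v, v ∈ C → v ∈ F := by
    rintro v ⟨s, hs, rfl⟩
    exact Finset.mem_image_of_mem _ (by simpa using hs)
  have hC' : ∀ s < ℓ, c' s ∉ C := by
    rintro s hs ⟨t, ht, he⟩
    exact hdisj t ht s hs he
  have hz : ∀ s < ℓ, ∃ z, z ∉ C ∧ (∀ t < ℓ, z ≠ c' t) ∧ G.Adj (c s) z ∧ G.Adj (c' s) z := by
    intro s hs
    have h1 := h.cod_ge_of_nbrDist_lt (htw s hs)
    have h2 := Finset.card_union_le F F'
    obtain ⟨z, hz, hz'⟩ := exists_common_nbr (F := F ∪ F') (x := c s) (y := c' s) (G := G) (by lia)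
    rw [Finset.mem_union, not_or] at hz
    refine ⟨z, fun hzC => hz.1 (hmemF z hzC), ?_, hz'⟩
    rintro t ht rfl
    exact hz.2 (Finset.mem_image_of_mem _ (by simpa using ht))
  rcases (show ℓ + 2 ≤ 2 * k - 3 ∨ ℓ = 2 * k - 3 by lia) with hlt | heq
  · obtain ⟨z, hzC, hzC', hz1, hz2⟩ := hz 0 (by lia)
    have p1 := hc.path_around (show 0 < 1 by lia) (by lia)
    have p2 := ((HasPath.single (hc'.1 0 (by lia))).cons hz2.symm (by
      rintro (rfl | rfl)
      · exact hzC' 0 (by lia) rfl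
      · exact hzC' 1 (by lia) rfl)).cons hz1 (by
        rintro (he | he | he)
        · exact hz1.ne he
        · exact hdisj _ (by lia) _ (by lia) he
        · exact hdisj _ (by lia) 1 (by lia) he)
    have p3 := p1.append p2 (by
      rintro v hv (rfl | rfl | rfl | rfl)
      · rfl
      · exact absurd hv hzC
      · exact absurd hv (hC' 0 (by lia))
      · exact absurd hv (hC' 1 (by lia)))
    refine h.no_odd_path ?_ p3 ⟨n + 1, by lia⟩ (by lia)
    have := h.cod_ge_of_nbrDist_lt (htw 1 (by lia))
    simp only [zero_add]
    lia
  · have hα : ∀ s < ℓ, ∀ t < ℓ, s ≠ t → cod G (c s) (c t) < 4 * q := by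
      intro s hs t ht hst
      by_contra! hcon
      obtain ⟨L, ⟨m, hm⟩, hL, p1⟩ := hc.odd_arc hodd hs ht hst
      obtain ⟨z, hzC, hzC', hz1, hz2⟩ := hz t ht
      have p2 := (HasPath.single hz2.symm).cons hz1 (by
        rintro (he | he)
        · exact hz1.ne he
        · exact hdisj _ ht _ ht he)
      have p3 := p1.append p2 (by
        rintro v hv (rfl | rfl | rfl)
        · rfl
        · exact absurd hv hzC
        · exact absurd hv (hC' t ht))
      refine h.no_odd_path ?_ p3 ⟨m + 1, by lia⟩ (by lia)
      rw [cod_comm] at hcon ⊢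
      have := cod_ge_of_nbrDist (htw t ht) hcon
      lia
    have hβ : ∀ z r, r < ℓ → z ∉ C → G.Adj z (c r) → ∀ s < ℓ, cod G z (c s) < 4 * q := by
      intro z r hr hzC hzr s hs
      by_contra! hcon
      obtain ⟨L, ⟨m, hm⟩, hL, p1⟩ := hc.even_arc hodd hr hs
      exact h.no_odd_path (by lia) (p1.cons hzr hzC) ⟨m, by lia⟩ (by lia)
    obtain ⟨z, hz0, hzF⟩ := Finset.exists_mem_notMem_of_card_lt_card (s := F) (t := nbr G (c 0))
      (by have := h.deg (c 0); lia)
    obtain ⟨z', hz0', hzF'⟩ := Finset.exists_mem_notMem_of_card_lt_card (s := insert z F)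
      (t := nbr G (c 1)) (by
        have := h.deg (c 1)
        have := Finset.card_insert_le z F
        lia)
    rw [mem_nbr] at hz0 hz0'
    rw [Finset.mem_insert, not_or] at hzF'
    have hzC : z ∉ C := fun hv => hzF (hmemF z hv)
    have hzC' : z' ∉ C := fun hv => hzF'.2 (hmemF z' hv)
    have hγ : cod G z z' < 4 * q := by
      by_contra! hcon
      have p1 := ((HasPath.single hz0').cons (hc.1 0 (by lia)) (by
        rintro (he | he)
        · exact (hc.1 0 (by lia)).ne he
        · exact hzC' ⟨0, by simp; lia, he⟩)).cons hz0.symm (by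
          rintro (he | he | he)
          · exact hz0.ne he.symm
          · exact hzC ⟨1, by simp; lia, he.symm⟩
          · exact hzF'.1 he.symm)
      exact h.no_odd_path (by lia) p1 ⟨1, by lia⟩ (by lia)
    obtain ⟨x, hx, y, hy, hxy, hcxy⟩ := h.pigeon (insert z' (insert z F)) (by
      rw [Finset.card_insert_of_notMem (by simpa using hzF'), Finset.card_insert_of_notMem hzF]
      lia)
    have hmem : ∀ v, v ∈ F → ∃ s < ℓ, v = c s := by
      intro v hv
      obtain ⟨s, hs, rfl⟩ := Finset.mem_image.1 hv
      exact ⟨s, by simpa using hs, rfl⟩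
    have hβ1 := hβ z 0 (by lia) hzC hz0.symm
    have hβ2 := hβ z' 1 (by lia) hzC' hz0'.symm
    simp only [Finset.mem_insert] at hx hy
    rcases hx with rfl | rfl | hx <;> rcases hy with rfl | rfl | hy
    · exact hxy rfl
    · rw [cod_comm] at hcxy
      lia
    · obtain ⟨s, hs, rfl⟩ := hmem y hy
      have := hβ2 s hs
      lia
    · lia
    · exact hxy rfl
    · obtain ⟨s, hs, rfl⟩ := hmem y hy
      have := hβ1 s hs
      lia
    · obtain ⟨s, hs, rfl⟩ := hmem x hx
      have := hβ2 s hs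
      rw [cod_comm] at hcxy
      lia
    · obtain ⟨s, hs, rfl⟩ := hmem x hx
      have := hβ1 s hs
      rw [cod_comm] at hcxy
      lia
    · obtain ⟨s, hs, rfl⟩ := hmem x hx
      obtain ⟨t, ht, rfl⟩ := hmem y hy
      have := hα s hs t ht (fun he => hxy (by rw [he]))
      lia

/-- A bounded number of vertices meets all short odd cycles. -/
lemma DenseMaximal.exists_hitting (h : DenseMaximal G k q A K) {R : ℕ} (cls : V → Fin R)
    (hcls : ∀ v w, cls v = cls w → nbrDist G v w < 2 * q) :
    ∃ B : Finset V, B.card ≤ 2 * k * (2 * k * R ^ (2 * k) + 1) ∧ ∀ ℓ c, Odd ℓ → ℓ ≤ 2 * k - 3 →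
      IsCycleSeq G ℓ c → ∃ i < ℓ, c i ∈ B := by
  have hk := h.three_le
  rcases exists_hitting_or_disjoint G k (2 * k * R ^ (2 * k) + 1) with hB | ⟨l, c, h1, h2⟩
  · exact hB
  exfalso
  set m := 2 * k * R ^ (2 * k) + 1 with hm
  obtain ⟨i, hi, j, hj, hij, he⟩ := Finset.exists_ne_map_eq_of_card_lt_of_maps_to
    (s := Finset.range m)
    (t := Finset.range (2 * k) ×ˢ (Finset.univ : Finset (Fin (2 * k) → Fin R)))
    (f := fun i => (l i, fun s : Fin (2 * k) => cls (c i s))) (by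
      rw [Finset.card_product]
      simp [hm]) (by
      intro i hi
      have := (h1 i (by simpa using hi)).2.1
      simp only [Finset.coe_product, Finset.coe_range, Finset.coe_univ, Set.mem_prod, Set.mem_Iio,
        Set.mem_univ, and_true]
      lia)
  rw [Finset.mem_range] at hi hj
  wlog hlt : i < j generalizing i j
  · exact this j hj i hi hij.symm he.symm (by lia)
  simp only [Prod.mk.injEq] at he
  have hi1 := h1 i hi
  have hj1 := h1 j hj
  rw [← he.1] at hj1
  have hd := h2 i j hlt hj
  rw [← he.1] at hd
  refine h.no_twin_cycles hi1.2.2 hj1.2.2 hi1.1 hi1.2.1 hd fun s hs => hcls _ _ ?_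
  exact congrFun he.2 ⟨s, by lia⟩

end HittingSet

section Types

variable {V : Type*} [Fintype V] [DecidableEq V] {G : SimpleGraph V} {k q A K : ℕ} {Λ : Type*}

/-- The label sequences of the paths of length `L` which start at `u`. -/
def pathTypes {V Λ : Type*} (G : SimpleGraph V) (lab : V → Λ) (L : ℕ) (u : V) :
    Set (Fin (L + 1) → Λ) :=
  {σ | ∃ y, IsWalkSeq G L y ∧ Set.InjOn y (Set.Iic L) ∧ y 0 = u ∧
    ∀ i : Fin (L + 1), σ i = lab (y i)}

lemma DenseMaximal.no_path_of_types (h : DenseMaximal G k q A K) {B : Finset V}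
    (hB : B.card + 6 * k ≤ K)
    (hhit : ∀ ℓ c, Odd ℓ → ℓ ≤ 2 * k - 3 → IsCycleSeq G ℓ c → ∃ i < ℓ, c i ∈ B)
    {lab : V → Λ}
    (hlab : ∀ v w, lab v = lab w → v = w ∨ v ∉ B ∧ w ∉ B ∧ nbrDist G v w < 2 * q)
    {u u' v : V} (hadj : G.Adj u v)
    (htyp : pathTypes G lab (2 * k - 2) u' ⊆ pathTypes G lab (2 * k - 2) u) (S : Set V) :
    ¬ HasPath G S (2 * k - 2) u' v := by
  have hk := h.three_le
  have hKq := h.K_le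
  induction hN : ((B : Set V) ∩ S).ncard using Nat.strong_induction_on generalizing S with
  | _ N ih =>
  rintro ⟨x, hx, hinj, hx0, hx1, hxS⟩
  obtain ⟨y, hy, hyinj, hy0, hxy⟩ := htyp ⟨x, hx, hinj, hx0, fun i => rfl⟩
  have hxy : ∀ i ≤ 2 * k - 2, x i = y i ∨ x i ∉ B ∧ y i ∉ B ∧ nbrDist G (x i) (y i) < 2 * q :=
    fun i hi => hlab _ _ (hxy ⟨i, by lia⟩)
  have hinj' : ∀ i ≤ 2 * k - 2, ∀ j ≤ 2 * k - 2, x i = x j → i = j :=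
    fun i hi j hj hij => hinj hi hj hij
  by_cases hall : ∀ i ≤ 2 * k - 2, x i ∉ B
  · have hyB : ∀ i ≤ 2 * k - 2, y i ∉ B := by
      intro i hi
      rcases hxy i hi with he | he
      · exact he ▸ hall i hi
      · exact he.2.1
    obtain ⟨s, t, hst, ht, ⟨g, hg⟩, hcod⟩ := h.exists_even hx hinj
    have w1 := (hx.segment ht le_rfl).mono (T := {v | v ∉ B}) (by
      rintro _ ⟨m, hm, rfl⟩
      exact hall m hm.2)
    have w2 := (hy.segment (Nat.zero_le s) (by lia)).mono (T := {v | v ∉ B}) (by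
      rintro _ ⟨m, hm, rfl⟩
      exact hyB m (hm.2.trans (by lia)))
    have w3 : HasWalk G {v | v ∉ B} 1 (x (2 * k - 2)) (y 0) :=
      HasWalk.single (by rw [hx1, hy0]; exact hadj.symm) (hall _ le_rfl) (hyB _ (by lia))
    have hlen : 2 * k - 2 - t + 1 + (s - 0) = 2 * (k - 1 - g) + 1 := by lia
    rcases ((w1.append w3).append w2).exists_odd_path_or_cycle _ ⟨_, hlen⟩ with
      ⟨L, hL, hodd, hp⟩ | ⟨ℓ, hℓ, hodd, c, hc, hcB⟩
    · refine h.no_odd_path ?_ hp hodd (by lia)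
      rcases hxy s (by lia) with he | he
      · rw [← he, cod_comm]
        lia
      · rw [cod_comm]
        have := cod_ge_of_nbrDist he.2.2 hcod
        lia
    · obtain ⟨i, hi, hiB⟩ := hhit ℓ c hodd (by lia) hc
      exact hcB i hi.le hiB
  · push Not at hall
    have hall' := Nat.find_spec hall
    set b := Nat.find hall with hb
    obtain ⟨hbk, hbB⟩ := hall'
    have hmin : ∀ i < b, x i ∉ B := fun i hi hiB => Nat.find_min hall hi ⟨by lia, hiB⟩
    have hyb : y b = x b := by
      rcases hxy b hbk with he | he
      · exact he.symm
      · exact absurd hbB he.1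
    have hyB : ∀ i < b, y i ∉ B := by
      intro i hi
      rcases hxy i (by lia) with he | he
      · exact he ▸ hmin i hi
      · exact he.2.1
    by_cases hcross : ∃ i j, i < b ∧ b < j ∧ j ≤ 2 * k - 2 ∧ y i = x j
    · obtain ⟨i, j, hi, hj, hjk, hij⟩ := hcross
      have hxi : nbrDist G (x i) (x j) < 2 * q := by
        rcases hxy i (by lia) with he | he
        · have := hinj' i (by lia) j hjk (he.trans hij)
          lia
        · exact hij ▸ he.2.2
      have hcod := h.cod_ge_of_nbrDist_lt hxi
      rcases Nat.even_or_odd (j - i) with heven | hodd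
      · obtain ⟨g, hg⟩ : ∃ g, j - i = 2 * (g + 1) := by
          obtain ⟨m, hm⟩ := heven
          exact ⟨m - 1, by lia⟩
        set F := B ∪ (Finset.range (2 * k - 1)).image x with hF
        have hFc : F.card ≤ B.card + (2 * k - 1) := by
          refine (Finset.card_union_le _ _).trans (Nat.add_le_add_left ?_ _)
          exact Finset.card_image_le.trans (by simp)
        have hxF : ∀ m ≤ 2 * k - 2, x m ∈ F := fun m hm =>
          Finset.mem_union_right _ (Finset.mem_image_of_mem _ (by simp; lia))
        have p1 := hx.path_segment hinj (Nat.zero_le i) (by lia)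
        have p2 := h.jump g (x i) (x j) F
          (fun he => by have := hinj' i (by lia) j hjk he; lia) (by lia) (by lia)
        have p3 := hx.path_segment hinj hjk le_rfl
        have p4 := p1.append p2 (by
          rintro _ ⟨m, hm, rfl⟩ (he | he | he)
          · exact he
          · have := hinj' m (hm.2.trans (by lia)) j hjk he
            have := hm.2
            lia
          · exact absurd (hxF m (hm.2.trans (by lia))) he)
        have p5 := p4.append p3 (by
          rintro _ hv ⟨m, hm, rfl⟩
          rcases hv with ⟨m', hm', he⟩ | he | he | he
          · have := hinj' m' (hm'.2.trans (by lia)) m hm.2 he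
            have := hm'.2
            have := hm.1
            lia
          · have := hinj' m hm.2 i (by lia) he
            have := hm.1
            lia
          · exact he
          · exact absurd (hxF m hm.2) he)
        rw [hx0, hx1, show i - 0 + 2 * (g + 1) + (2 * k - 2 - j) = 2 * k - 2 by lia] at p5
        refine ih _ ?_ _ rfl p5
        rw [← hN]
        refine Set.ncard_lt_ncard ((Set.ssubset_iff_of_subset ?_).2 ⟨x b, ⟨hbB, hxS b hbk⟩, ?_⟩)
        · intro w hw
          refine ⟨hw.1, ?_⟩
          rcases hw.2 with (⟨m, hm, rfl⟩ | rfl | rfl | he) | ⟨m, hm, rfl⟩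
          · exact hxS m (hm.2.trans (by lia))
          · exact hxS i (by lia)
          · exact hxS j hjk
          · exact absurd (Finset.mem_union_left _ hw.1) he
          · exact hxS m hm.2
        · intro hw
          rcases hw.2 with (⟨m, hm, he⟩ | he | he | he) | ⟨m, hm, he⟩
          · have := hinj' m (hm.2.trans (by lia)) b hbk he
            have := hm.2
            lia
          · have := hinj' b hbk i (by lia) he
            lia
          · have := hinj' b hbk j hjk he
            lia
          · exact he (hxF b hbk)
          · have := hinj' m hm.2 b hbk he
            have := hm.1
            lia
      · have p := hx.path_segment hinj (show i ≤ j by lia) hjk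
        refine h.no_odd_path (by lia) p hodd ?_
        obtain ⟨m, hm⟩ := hodd
        lia
    · have p1 := hy.path_segment hyinj (Nat.zero_le b) hbk
      have p2 := hx.path_segment hinj hbk le_rfl
      rw [hyb] at p1
      have p3 := p1.append p2 (by
        rintro _ ⟨i, hi, rfl⟩ ⟨j, hj, he⟩
        rcases (show i = b ∨ i < b by have := hi.2; lia) with rfl | hib
        · exact hyb
        · rcases (show j = b ∨ b < j by have := hj.1; lia) with rfl | hjb
          · exact he.symm
          · exact absurd ⟨i, j, hib, hjb, hj.2, he.symm⟩ hcross)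
      rw [hy0, hx1, show b - 0 + (2 * k - 2 - b) = 2 * k - 2 by lia] at p3
      exact h.not_path u v hadj (p3.mono (Set.subset_univ _))

/-- Vertices with the same label and the same path types have the same neighbours. -/
lemma DenseMaximal.adj_of_types (h : DenseMaximal G k q A K) {B : Finset V}
    (hB : B.card + 6 * k ≤ K)
    (hhit : ∀ ℓ c, Odd ℓ → ℓ ≤ 2 * k - 3 → IsCycleSeq G ℓ c → ∃ i < ℓ, c i ∈ B)
    {lab : V → Λ}
    (hlab : ∀ v w, lab v = lab w → v = w ∨ v ∉ B ∧ w ∉ B ∧ nbrDist G v w < 2 * q)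
    {u u' v : V} (hadj : G.Adj u v) (huu : lab u = lab u')
    (htyp : pathTypes G lab (2 * k - 2) u' ⊆ pathTypes G lab (2 * k - 2) u) : G.Adj u' v := by
  have hk := h.three_le
  have hKq := h.K_le
  rcases hlab _ _ huu with rfl | ⟨-, -, hd⟩
  · exact hadj
  have hne : u' ≠ v := by
    rintro rfl
    have := h.cod_ge_of_nbrDist_lt hd
    exact h.no_odd_path (by lia) (HasPath.single hadj) (by decide) (by lia)
  by_contra hna
  exact h.no_path_of_types hB hhit hlab hadj htyp _ (h.path _ _ hne hna)

lemma isBlowupOf_of_fibers {V : Type} {T : Type} [Finite T] (G : SimpleGraph V) (f : V → T)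
    (hf : ∀ u u' v, f u = f u' → G.Adj u v → G.Adj u' v) :
    ∃ (W : Type) (_ : Finite W) (H : SimpleGraph W), Nat.card W ≤ Nat.card T ∧ IsBlowupOf G H := by
  have key : ∀ u u' v v', f u = f u' → f v = f v' → G.Adj u v → G.Adj u' v' :=
    fun u u' v v' hu hv huv => (hf v v' u' hv (hf u u' v hu huv).symm).symm
  refine ⟨Set.range f, inferInstance,
    { Adj := fun σ τ => ∃ u v, f u = σ ∧ f v = τ ∧ G.Adj u v
      symm := ?_
      loopless := ?_ }, Nat.card_le_card_of_injective _ Subtype.val_injective,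
    Set.rangeFactorization f, Set.rangeFactorization_surjective, ?_⟩
  · constructor
    rintro σ τ ⟨u, v, h1, h2, h3⟩
    exact ⟨v, u, h2, h1, h3.symm⟩
  · constructor
    rintro σ ⟨u, v, h1, h2, h3⟩
    exact (key u u v u rfl (h2.trans h1.symm) h3).ne rfl
  · intro u v _
    constructor
    · intro h
      exact ⟨u, v, rfl, rfl, h⟩
    · rintro ⟨u', v', h1, h2, h3⟩
      exact key u' u v' v h1 h2 h3

end Types

section Blowup

/-- A bound on the number of vertex classes used in the argument. -/
def classBound (k A : ℕ) : ℕ := (4 * A) ^ (A * (2 * k - 1) ^ 2 * (2 * k - 1) ^ (2 * k - 1))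

/-- A bound on the number of vertices needed to meet all short odd cycles. -/
def hittingBound (k A : ℕ) : ℕ := 2 * k * (2 * k * classBound k A ^ (2 * k) + 1)

lemma DenseMaximal.exists_isBlowupOf {V : Type} [Fintype V] [DecidableEq V] {G : SimpleGraph V}
    {k q A K : ℕ} (h : DenseMaximal G k q A K) (hK : hittingBound k A + 6 * k ≤ K) :
    ∃ (W : Type) (_ : Finite W) (H : SimpleGraph W),
      Nat.card W ≤ (classBound k A + hittingBound k A) *
        2 ^ ((classBound k A + hittingBound k A) ^ (2 * k - 1)) ∧ IsBlowupOf G H := by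
  classical
  have hk := h.three_le
  obtain ⟨cls, hcls⟩ := h.exists_classes
  obtain ⟨B, hB, hhit⟩ := h.exists_hitting cls hcls
  let Λ := Fin (classBound k A) ⊕ B
  let lab : V → Λ := fun v => if hv : v ∈ B then Sum.inr ⟨v, hv⟩ else Sum.inl (cls v)
  have hlab : ∀ v w, lab v = lab w → v = w ∨ v ∉ B ∧ w ∉ B ∧ nbrDist G v w < 2 * q := by
    intro v w hvw
    by_cases hv : v ∈ B <;> by_cases hw : w ∈ B <;> simp [lab, hv, hw] at hvw
    · exact Or.inl (congrArg Subtype.val (Sum.inr_injective hvw))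
    · exact Or.inr ⟨hv, hw, hcls v w (Sum.inl_injective hvw)⟩
  obtain ⟨W, hW, H, hWc, hWG⟩ := isBlowupOf_of_fibers (T := Λ × Set (Fin (2 * k - 2 + 1) → Λ)) G
    (fun u => (lab u, pathTypes G lab (2 * k - 2) u)) (fun u u' v hf hadj => by
      simp only [Prod.mk.injEq] at hf
      refine h.adj_of_types (B := B) ?_ hhit hlab hadj hf.1 hf.2.ge
      exact (Nat.add_le_add_right hB _).trans hK)
  have hΛ : Nat.card Λ ≤ classBound k A + hittingBound k A := by
    simp only [Λ, Nat.card_eq_fintype_card, Fintype.card_sum, Fintype.card_fin, Fintype.card_coe]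
    exact Nat.add_le_add_left hB _
  refine ⟨W, hW, H, hWc.trans ?_, hWG⟩
  rw [Nat.card_prod, Nat.card_eq_fintype_card (α := Set _), Fintype.card_set,
    ← Nat.card_eq_fintype_card, Nat.card_fun, Nat.card_fin,
    show 2 * k - 2 + 1 = 2 * k - 1 by lia]
  gcongr
  norm_num

end Blowup

section Dense

lemma card_nbr {V : Type*} [Fintype V] (G : SimpleGraph V) (v : V) :
    (nbr G v).card = (G.neighborSet v).ncard := by
  rw [← Set.ncard_coe_finset]
  congr 1
  ext w
  simp

/-- In a graph of minimum degree above `|V| / m`, any `m` vertices contain two with linearly many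
common neighbours. -/
lemma exists_cod_ge {V : Type*} [Fintype V] [DecidableEq V] {G : SimpleGraph V} {k q : ℕ} {ε : ℝ}
    (hk : 1 ≤ k) (hε : 0 < ε) (hV : 0 < Fintype.card V) (hq : 4 * k * (q : ℝ) ≤ ε * Fintype.card V)
    (hdeg : ∀ v, ((1 : ℝ) / (2 * (k : ℝ) - 1) + ε) * Fintype.card V ≤ (nbr G v).card)
    (T : Finset V) (hT : T.card = 2 * k - 1) :
    ∃ x ∈ T, ∃ y ∈ T, x ≠ y ∧ 4 * q ≤ cod G x y := by
  by_contra! hcon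
  have h1 := two_mul_sum_card_le T (nbr G)
  have h2 : ∑ p ∈ T.offDiag, (nbr G p.1 ∩ nbr G p.2).card ≤ T.offDiag.card * (4 * q) := by
    rw [← smul_eq_mul]
    refine Finset.sum_le_card_nsmul _ _ _ fun p hp => ?_
    rw [Finset.mem_offDiag] at hp
    exact (hcon p.1 hp.1 p.2 hp.2.1 hp.2.2).le
  have h3 : T.card • (((1 : ℝ) / (2 * (k : ℝ) - 1) + ε) * Fintype.card V) ≤
      ∑ v ∈ T, ((nbr G v).card : ℝ) := Finset.card_nsmul_le_sum _ _ _ fun v _ => hdeg v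
  obtain ⟨j, rfl⟩ : ∃ j, k = j + 1 := ⟨k - 1, by lia⟩
  rw [Finset.offDiag_card, hT, show 2 * (j + 1) - 1 = 2 * j + 1 by lia,
    show (2 * j + 1) * (2 * j + 1) - (2 * j + 1) = (2 * j + 1) * (2 * j) from
      Nat.sub_eq_of_eq_add (by ring)] at h2
  rw [hT, show 2 * (j + 1) - 1 = 2 * j + 1 by lia, nsmul_eq_mul] at h3
  have h4 : (2 : ℝ) * ∑ v ∈ T, ((nbr G v).card : ℝ) ≤
      2 * Fintype.card V + (2 * j + 1) * (2 * j) * (4 * q) := by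
    exact_mod_cast h1.trans (Nat.add_le_add_left h2 _)
  push_cast at h3 hq
  set n : ℝ := (Fintype.card V : ℝ) with hn
  have hn0 : 0 < n := Nat.cast_pos.2 hV
  have hj : (0 : ℝ) ≤ j := Nat.cast_nonneg j
  rw [show (2 * ((j : ℝ) + 1) - 1) = 2 * j + 1 by ring] at h3
  have h5 : (2 * (j : ℝ) + 1) * ((1 / (2 * (j : ℝ) + 1) + ε) * n) =
      n + (2 * j + 1) * (ε * n) := by
    field_simp
  rw [h5] at h3
  have h6 : 0 < ε * n := by positivity
  have h7 : (2 * (j : ℝ) + 1) * (2 * j) * (4 * q) ≤ (2 * j + 1) * 2 * (ε * n - 4 * q) := by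
    have : (2 * (j : ℝ) + 1) * 2 * (4 * (j + 1) * q) ≤ (2 * (j : ℝ) + 1) * 2 * (ε * n) := by
      gcongr
    linarith
  have h8 : (0 : ℝ) ≤ q := Nat.cast_nonneg q
  have h9 : 2 * ((2 * (j : ℝ) + 1) * (ε * n)) ≤ (2 * j + 1) * 2 * (ε * n - 4 * q) := by linarith
  have h10 : 0 ≤ (2 * (j : ℝ) + 1) * q := by positivity
  have h11 : (2 * (j : ℝ) + 1) * q = 0 := by linarith
  have h12 : (q : ℝ) = 0 := by
    rcases mul_eq_zero.1 h11 with h | h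
    · linarith
    · exact h
  rw [h12] at h4
  nlinarith [mul_pos (show (0 : ℝ) < 2 * j + 1 by linarith) h6]

lemma MaximalCLFree.denseMaximal {V : Type*} [Fintype V] [DecidableEq V] {G : SimpleGraph V}
    {k A K : ℕ} {ε : ℝ} (hG : MaximalCLFree G (2 * k - 1)) (hk : 3 ≤ k) (hε : 0 < ε)
    (hA : 16 * k ≤ A * ε) (hA1 : 1 ≤ A) (hK : 6 * k ≤ K)
    (hV : 8 * k * (A * K) ≤ ε * Fintype.card V)
    (hdeg : ∀ v, ((1 : ℝ) / (2 * (k : ℝ) - 1) + ε) * Fintype.card V ≤ (nbr G v).card) :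
    DenseMaximal G k ⌊ε * Fintype.card V / (4 * k)⌋₊ A K := by
  set n := Fintype.card V with hn
  set q := ⌊ε * n / (4 * k)⌋₊ with hq
  have hk0 : (3 : ℝ) ≤ k := by exact_mod_cast hk
  have hAK : (1 : ℝ) ≤ A * K := by
    have : 1 ≤ A * K := Nat.mul_pos hA1 (by lia)
    exact_mod_cast this
  have hεn : 0 < ε * n := lt_of_lt_of_le (by positivity) hV
  have hn0 : 0 < n := by
    rcases Nat.eq_zero_or_pos n with h | h
    · simp [h] at hεn
    · exact h
  have hq1 : 4 * k * (q : ℝ) ≤ ε * n := by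
    have := Nat.floor_le (show 0 ≤ ε * n / (4 * k) by positivity)
    rw [le_div_iff₀ (by positivity)] at this
    linarith
  have hq2 : ε * n ≤ 8 * k * q := by
    have := (Nat.lt_floor_add_one (ε * n / (4 * k))).le
    rw [div_le_iff₀ (by positivity)] at this
    nlinarith
  refine ⟨hk, ?_, ?_, ?_, ?_, ?_, hK, hA1, ?_⟩
  · intro u v hadj hp
    have := hp.hasCycleOfLength (by lia) hadj
    rw [show 2 * k - 2 + 1 = 2 * k - 1 by lia] at this
    exact hG.1 this
  · intro u v huv hadj
    exact hG.hasPath huv hadj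
  · intro v
    have h1 := hdeg v
    have h2 : (0 : ℝ) ≤ 1 / (2 * k - 1) := div_nonneg zero_le_one (by linarith)
    have h3 : (4 : ℝ) * q ≤ (nbr G v).card := by
      have : 0 ≤ 1 / (2 * (k : ℝ) - 1) * n := by positivity
      have : (4 : ℝ) * q ≤ 4 * k * q := by
        have : (0 : ℝ) ≤ q := Nat.cast_nonneg q
        nlinarith
      linarith
    exact_mod_cast h3
  · exact exists_cod_ge (by lia) hε hn0 hq1 hdeg
  · have h1 : ε * (2 * n) ≤ ε * (A * q) := by
      have : (16 * (k : ℝ)) * q ≤ A * ε * q := by gcongr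
      linarith
    have h2 := le_of_mul_le_mul_left h1 hε
    exact_mod_cast h2
  · have h1 : 8 * (k : ℝ) * (A * K) ≤ 8 * k * q := hV.trans hq2
    have h2 := le_of_mul_le_mul_left h1 (by positivity)
    exact_mod_cast h2

end Dense

section Numerics

lemma tw_mono (x : ℕ) : Monotone fun i => tw i x :=
  monotone_nat_of_le_succ fun i => Nat.le_mul_of_pos_right _ (by positivity)

lemma mul_two_pow_le_tw {N m k r : ℕ} (hk : 3 ≤ k) (hm : m ≠ 0) (h : N ^ m ≤ 2 ^ r) (hr : 1 ≤ r) :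
    N * 2 ^ N ^ m ≤ tw (k - 1) r := by
  refine le_trans ?_ (tw_mono r (show 2 ≤ k - 1 by lia))
  have h1 : N ^ m ≤ r * 2 ^ r := h.trans (Nat.le_mul_of_pos_left _ hr)
  change N * 2 ^ N ^ m ≤ r * 2 ^ r * 2 ^ (r * 2 ^ r)
  gcongr
  · exact (Nat.le_pow (Nat.pos_of_ne_zero hm)).trans h1
  · norm_num

lemma classBound_add_hittingBound_pow_le {k A : ℕ} (hk : 1 ≤ k) (hA : 1 ≤ A) :
    (classBound k A + hittingBound k A) ^ (2 * k - 1) ≤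
      2 ^ (24 * k ^ 2 * A ^ 2 * (2 * k - 1) ^ (2 * k + 1)) := by
  set p := A * (2 * k - 1) ^ (2 * k + 1) with hp
  have hC : classBound k A = (4 * A) ^ p := by
    rw [classBound, hp, mul_assoc, ← pow_add, show 2 + (2 * k - 1) = 2 * k + 1 by lia]
  have hC1 : 1 ≤ classBound k A := by
    rw [hC]
    exact Nat.one_le_pow _ _ (by lia)
  have hC2 : classBound k A ≤ 2 ^ (4 * A * p) := by
    rw [hC, pow_mul _ (4 * A) p]
    exact Nat.pow_le_pow_left Nat.lt_two_pow_self.le _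
  have hp1 : 1 ≤ A * p := by
    refine Nat.mul_pos hA (Nat.mul_pos hA (Nat.pow_pos (by lia)))
  have hk2 : 2 * k + 1 ≤ 2 ^ (2 * k) := Nat.lt_two_pow_self
  have hC3 : classBound k A ≤ classBound k A ^ (2 * k) := Nat.le_pow (by lia)
  have hN : classBound k A + hittingBound k A ≤ 2 ^ (12 * k * (A * p)) := calc
    _ ≤ (2 * k + 1) ^ 2 * classBound k A ^ (2 * k) := by
      rw [hittingBound]
      nlinarith
    _ ≤ (2 ^ (2 * k)) ^ 2 * (2 ^ (4 * A * p)) ^ (2 * k) := by gcongr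
    _ = 2 ^ (4 * k + 8 * k * (A * p)) := by
      rw [← pow_mul, ← pow_mul, ← pow_add]
      ring_nf
    _ ≤ _ := Nat.pow_le_pow_right two_pos (by nlinarith)
  calc
    _ ≤ (2 ^ (12 * k * (A * p))) ^ (2 * k) :=
      (Nat.pow_le_pow_left hN _).trans (Nat.pow_le_pow_right (by positivity) (by lia))
    _ = _ := by
      rw [← pow_mul, hp]
      ring_nf

lemma le_vcBound {k : ℕ} (hk : 3 ≤ k) : 2 * k + 5 ≤ vcBound k := by
  have h1 : 1 ≤ Nat.choose (2 * k - 2) (k - 1) := Nat.choose_pos (by lia)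
  have h2 : 1 ≤ 2 ^ (2 * k - 1) ^ (2 * k - 2) := Nat.one_le_two_pow
  have h3 : (2 * k - 1) ^ 3 ≤ vcBound k := by
    rw [vcBound, mul_assoc]
    exact Nat.le_mul_of_pos_right _ (Nat.mul_pos h1 h2)
  have h4 : 5 * 5 * (2 * k - 1) ≤ (2 * k - 1) ^ 3 := by
    rw [pow_succ, pow_two]
    gcongr <;> lia
  lia

lemma le_ceil_vcBound {k A : ℕ} {ε : ℝ} (hk : 3 ≤ k) (hε : 0 < ε) (hε1 : ε < 1)
    (hA : (A : ℝ) ≤ 16 * k / ε + 1) :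
    24 * k ^ 2 * A ^ 2 * (2 * k - 1) ^ (2 * k + 1) ≤
      ⌈Real.exp 1 * ((vcBound k : ℝ) + 1) *
        ((12 * (k : ℝ) * Real.exp 1) / ε) ^ (vcBound k)⌉₊ := by
  have he : (2.7 : ℝ) ≤ Real.exp 1 := by linarith [Real.exp_one_gt_d9]
  have hk0 : (3 : ℝ) ≤ k := by exact_mod_cast hk
  set y : ℝ := 32 * k / ε with hy
  have hyk : 32 * (k : ℝ) ≤ y := by
    rw [hy, le_div_iff₀ hε]
    nlinarith
  have hAy : (A : ℝ) ≤ y := by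
    have : 16 * (k : ℝ) / ε = y / 2 := by rw [hy]; ring
    linarith
  have hxy : y ≤ 12 * (k : ℝ) * Real.exp 1 / ε := by
    rw [hy]
    refine div_le_div_of_nonneg_right ?_ hε.le
    nlinarith
  have h1 : ((24 * k ^ 2 * A ^ 2 * (2 * k - 1) ^ (2 * k + 1) : ℕ) : ℝ) ≤ y ^ (2 * k + 5) := by
    have h2 : ((2 * k - 1 : ℕ) : ℝ) ≤ y := by
      have : ((2 * k - 1 : ℕ) : ℝ) ≤ ((2 * k : ℕ) : ℝ) := Nat.cast_le.2 (by lia)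
      push_cast at this
      linarith
    have h3 : 24 * (k : ℝ) ^ 2 ≤ y ^ 2 := by nlinarith
    rw [Nat.cast_mul, Nat.cast_mul, Nat.cast_mul, Nat.cast_pow, Nat.cast_pow, Nat.cast_pow]
    push_cast
    calc
      _ ≤ y ^ 2 * y ^ 2 * y ^ (2 * k + 1) := by gcongr
      _ = _ := by ring
  have h4 : y ^ (2 * k + 5) ≤ (12 * (k : ℝ) * Real.exp 1 / ε) ^ vcBound k :=
    (pow_le_pow_right₀ (by linarith) (le_vcBound hk)).trans
      (pow_le_pow_left₀ (by linarith) hxy _)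
  have h5 : (1 : ℝ) ≤ Real.exp 1 * ((vcBound k : ℝ) + 1) := by
    have : (0 : ℝ) ≤ vcBound k := Nat.cast_nonneg _
    nlinarith
  have h6 : (12 * (k : ℝ) * Real.exp 1 / ε) ^ vcBound k ≤ Real.exp 1 * ((vcBound k : ℝ) + 1) *
      (12 * (k : ℝ) * Real.exp 1 / ε) ^ vcBound k :=
    le_mul_of_one_le_left (by positivity) h5
  exact_mod_cast ((h1.trans h4).trans h6).trans (Nat.le_ceil _)

end Numerics

/-- Upper bound of Theorem 1.3: for `k ≥ 3` and `ε > 0`, every sufficiently large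
`n`-vertex maximal `C_{2k−1}`-free graph with minimum degree at least
`(1/(2k−1) + ε)·n` is a blowup of a graph on at most `tw_k(r)` vertices, where
`r = ⌈e(d+1)(12ke/ε)^d⌉` and `d` is the VC bound of Theorem 1.5. -/
theorem blowup_threshold_upper (k : ℕ) (hk : 3 ≤ k) (ε : ℝ) (hε : 0 < ε) :
    ∃ n₀ : ℕ, ∀ (V : Type) [Fintype V], n₀ ≤ Nat.card V →
      ∀ G : SimpleGraph V, MaximalCLFree G (2 * k - 1) →
        (∀ v : V,
          ((1 : ℝ) / (2 * (k : ℝ) - 1) + ε) * (Nat.card V) ≤ (G.neighborSet v).ncard) →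
        ∃ (W : Type) (_ : Finite W) (H : SimpleGraph W),
          Nat.card W ≤
            tw (k - 1)
              (⌈Real.exp 1 * ((vcBound k : ℝ) + 1) *
                  ((12 * (k : ℝ) * Real.exp 1) / ε) ^ (vcBound k)⌉₊) ∧
          IsBlowupOf G H := by
  set A := ⌈16 * (k : ℝ) / ε⌉₊ with hA
  set K := hittingBound k A + 6 * k with hK
  have hk0 : (3 : ℝ) ≤ k := by exact_mod_cast hk
  have hA1 : 1 ≤ A := Nat.ceil_pos.2 (by positivity)
  refine ⟨⌈8 * k * (A * K) / ε⌉₊ + 1, fun V _ hn G hG hdeg => ?_⟩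
  classical
  rw [Nat.card_eq_fintype_card] at hn
  simp only [Nat.card_eq_fintype_card (α := V), ← card_nbr] at hdeg
  have hn0 : 0 < Fintype.card V := by lia
  obtain ⟨v⟩ := Fintype.card_pos_iff.1 hn0
  have hε1 : ε < 1 := by
    have h1 := hdeg v
    have h2 : ((nbr G v).card : ℝ) ≤ Fintype.card V := by exact_mod_cast Finset.card_le_univ _
    have h3 : (0 : ℝ) < Fintype.card V := by exact_mod_cast hn0
    have h4 : (0 : ℝ) < 1 / (2 * k - 1) := div_pos one_pos (by linarith)
    have h5 := le_of_mul_le_mul_right ((h1.trans h2).trans_eq (one_mul _).symm) h3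
    linarith
  have hV : 8 * k * (A * K) ≤ ε * Fintype.card V := by
    have h1 : 8 * (k : ℝ) * (A * K) / ε ≤ Fintype.card V :=
      (Nat.le_ceil _).trans (Nat.cast_le.2 (by lia))
    rw [div_le_iff₀ hε] at h1
    linarith
  have hD := hG.denseMaximal hk hε ((div_le_iff₀ hε).1 (Nat.le_ceil _)) hA1
    (Nat.le_add_left _ _) hV hdeg
  obtain ⟨W, hW, H, hcard, hblow⟩ := hD.exists_isBlowupOf le_rfl
  refine ⟨W, hW, H, hcard.trans ?_, hblow⟩
  have hr := le_ceil_vcBound hk hε hε1 (Nat.ceil_lt_add_one (by positivity)).le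
  refine mul_two_pow_le_tw hk (by lia) ((classBound_add_hittingBound_pow_le (by lia) hA1).trans
    (Nat.pow_le_pow_right two_pos hr)) (le_trans ?_ hr)
  have : 0 < 2 * k - 1 := by lia
  exact Nat.mul_pos (by positivity) (Nat.pow_pos this)
end

section
/- Lower bound of Theorem 1.3: For every integer k ≥ 2 and every integer r ≥ 1, there exists a graph G on N = (2k−1)(r−1)+2 vertices that is maximal C_{2k−1}-free, has minimum degree at least N/(2k−1), and in which any two distinct vertices have distinct neighborhoods (so G is not a blowup of any graph on fewer than N vertices). -/
open SimpleGraph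

namespace SimpleGraph

variable {V : Type*} {G : SimpleGraph V}

theorem exists_walk_support_eq_map_range (f : ℕ → V) (n : ℕ)
    (hf : ∀ i < n, G.Adj (f i) (f (i + 1))) :
    ∃ p : G.Walk (f 0) (f n), p.support = (List.range (n + 1)).map f := by
  induction n with
  | zero => exact ⟨Walk.nil, by simp⟩
  | succ n ih =>
    obtain ⟨p, hp⟩ := ih fun i hi => hf i (by omega)
    refine ⟨p.concat (hf n (by omega)), ?_⟩
    rw [Walk.support_concat, hp, List.range_succ (n := n + 1)]
    simp

/-- A path of length `n` between non-adjacent vertices closes up to a cycle of length `n + 1`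
once its endpoints are joined. -/
theorem hasCycleOfLength_sup_of_path {u v : V} {n : ℕ} (f : ℕ → V)
    (hf : ∀ i < n, G.Adj (f i) (f (i + 1))) (hinj : Set.InjOn f (Set.Iic n))
    (hu : f 0 = u) (hv : f n = v) (huv : u ≠ v) (hnadj : ¬ G.Adj u v) :
    HasCycleOfLength (G ⊔ fromEdgeSet {s(u, v)}) (n + 1) := by
  subst hu hv
  obtain ⟨p, hp⟩ := exists_walk_support_eq_map_range f n hf
  have hpath : p.IsPath := by
    rw [Walk.isPath_def, hp]
    refine List.Nodup.map_on (fun i hi j hj h => hinj ?_ ?_ h) List.nodup_range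
    · simpa [Nat.lt_succ_iff] using hi
    · simpa [Nat.lt_succ_iff] using hj
  have hlen : p.length = n := by
    have h := p.length_support
    simp [hp] at h
    omega
  have hadj : (G ⊔ fromEdgeSet {s(f 0, f n)}).Adj (f n) (f 0) := by
    simp [huv.symm, Sym2.eq_swap]
  refine ⟨f n, Walk.cons hadj (p.mapLe le_sup_left), ?_, by simp [hlen]⟩
  rw [Walk.cons_isCycle_iff]
  refine ⟨by simpa using hpath, fun h => hnadj ?_⟩
  rw [Walk.edges_mapLe_eq_edges] at h
  exact (p.adj_of_mem_edges h).symm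

theorem hasCycleOfLength_sup_swap {u v : V} {n : ℕ}
    (h : HasCycleOfLength (G ⊔ fromEdgeSet {s(u, v)}) n) :
    HasCycleOfLength (G ⊔ fromEdgeSet {s(v, u)}) n := by
  rwa [Sym2.eq_swap]

/-- The circulant graph on `2b + s + 2` vertices in which two vertices are adjacent when their
circular distance exceeds `b`. For `b = (k - 1) * s` this is a generalized Andrásfai graph. -/
def circulantFar (b s : ℕ) : SimpleGraph (Fin (2 * b + s + 2)) where
  Adj u v :=
    (b + (v : ℕ) < u ∧ (u : ℕ) + b < 2 * b + s + 2 + v) ∨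
      (b + (u : ℕ) < v ∧ (v : ℕ) + b < 2 * b + s + 2 + u)
  symm := ⟨fun _ _ h => h.symm⟩
  loopless := ⟨fun _ h => by omega⟩

theorem circulantFar_adj {b s : ℕ} {u v : Fin (2 * b + s + 2)} :
    (circulantFar b s).Adj u v ↔
      ((b + (v : ℕ) < u ∧ (u : ℕ) + b < 2 * b + s + 2 + v) ∨
        (b + (u : ℕ) < v ∧ (v : ℕ) + b < 2 * b + s + 2 + u)) :=
  Iff.rfl

/-- The image of `u` under the rotation by `p` in `Fin N`. -/
def finRotate {N : ℕ} (u : Fin N) (p : ℕ) : Fin N :=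
  ⟨(u + p) % N, Nat.mod_lt _ u.pos⟩

theorem finRotate_val {N : ℕ} (u : Fin N) {p : ℕ} (hp : p < N) :
    ((finRotate u p : Fin N) : ℕ) = if u + p < N then (u : ℕ) + p else u + p - N := by
  have := u.isLt
  split_ifs with h
  · exact Nat.mod_eq_of_lt h
  · change (u + p) % N = _
    rw [Nat.mod_eq_sub_mod (by omega), Nat.mod_eq_of_lt (by omega)]

theorem finRotate_injOn {N : ℕ} (u : Fin N) : Set.InjOn (finRotate u) (Set.Iio N) := by
  intro p hp q hq h
  have hp' : p < N := hp
  have hq' : q < N := hq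
  have h' := congrArg Fin.val h
  rw [finRotate_val u hp', finRotate_val u hq'] at h'
  have := u.isLt
  split_ifs at h' <;> omega

theorem circulantFar_adj_finRotate {b s p q : ℕ} (u : Fin (2 * b + s + 2))
    (hp : p < 2 * b + s + 2) (hq : q < 2 * b + s + 2) :
    (circulantFar b s).Adj (finRotate u p) (finRotate u q) ↔
      ((b + q < p ∧ p + b < 2 * b + s + 2 + q) ∨ (b + p < q ∧ q + b < 2 * b + s + 2 + p)) := by
  rw [circulantFar_adj, finRotate_val u hp, finRotate_val u hq]
  have := u.isLt
  split_ifs <;> omega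

theorem finRotate_zero {N : ℕ} (u : Fin N) : finRotate u 0 = u :=
  Fin.ext (Nat.mod_eq_of_lt u.isLt)

theorem exists_finRotate_eq_of_not_adj {b s : ℕ} {u v : Fin (2 * b + s + 2)} (huv : u ≠ v)
    (h : ¬ (circulantFar b s).Adj u v) :
    ∃ x, 1 ≤ x ∧ x ≤ b ∧ (finRotate u x = v ∨ finRotate v x = u) := by
  have huv' : (u : ℕ) ≠ v := fun e => huv (Fin.ext e)
  rw [circulantFar_adj] at h
  have hu := u.isLt
  have hv := v.isLt
  have key : ∀ (a c : Fin (2 * b + s + 2)) (x : ℕ), x < 2 * b + s + 2 →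
      ((a : ℕ) + x = c ∨ (a : ℕ) + x = c + (2 * b + s + 2)) → finRotate a x = c := by
    intro a c x hx h
    apply Fin.ext
    rw [finRotate_val a hx]
    have := a.isLt
    have := c.isLt
    split_ifs <;> omega
  rcases lt_or_gt_of_ne huv' with hlt | hlt
  · by_cases hd : (v : ℕ) ≤ b + u
    · exact ⟨v - u, by omega, by omega, .inl (key _ _ _ (by omega) (by omega))⟩
    · exact ⟨u + (2 * b + s + 2) - v, by omega, by omega,
        .inr (key _ _ _ (by omega) (by omega))⟩
  · by_cases hd : (u : ℕ) ≤ b + v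
    · exact ⟨u - v, by omega, by omega, .inr (key _ _ _ (by omega) (by omega))⟩
    · exact ⟨v + (2 * b + s + 2) - u, by omega, by omega,
        .inl (key _ _ _ (by omega) (by omega))⟩

theorem circulantFar_neighborSet_injective {b s : ℕ} {u v : Fin (2 * b + s + 2)} (huv : u ≠ v) :
    (circulantFar b s).neighborSet u ≠ (circulantFar b s).neighborSet v := by
  intro heq
  have hiff : ∀ w, (circulantFar b s).Adj u w ↔ (circulantFar b s).Adj v w := fun w =>
    Set.ext_iff.mp heq w
  have hn : ¬ (circulantFar b s).Adj u v := fun h => (circulantFar b s).irrefl ((hiff v).mp h)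
  have key : ∀ (a : Fin (2 * b + s + 2)) (x : ℕ), 1 ≤ x → x ≤ b →
      ¬ ∀ w, (circulantFar b s).Adj a w ↔ (circulantFar b s).Adj (finRotate a x) w := by
    intro a x hx hxb h
    have h' := h (finRotate a (b + 1))
    nth_rewrite 1 [← finRotate_zero a] at h'
    rw [circulantFar_adj_finRotate a (by omega) (by omega),
      circulantFar_adj_finRotate a (by omega) (by omega)] at h'
    omega
  obtain ⟨x, hx, hxb, rfl | rfl⟩ := exists_finRotate_eq_of_not_adj huv hn
  · exact key u x hx hxb hiff
  · exact key v x hx hxb fun w => (hiff w).symm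

theorem succ_le_ncard_neighborSet_circulantFar {b s : ℕ} (u : Fin (2 * b + s + 2)) :
    s + 1 ≤ ((circulantFar b s).neighborSet u).ncard := by
  have hinj : Set.InjOn (fun j => finRotate u (b + 1 + j)) (Finset.range (s + 1) : Set ℕ) := by
    intro i hi j hj h
    simp only [Finset.coe_range, Set.mem_Iio] at hi hj
    have := finRotate_injOn u (Set.mem_Iio.mpr (by omega)) (Set.mem_Iio.mpr (by omega)) h
    omega
  have hsub : (fun j => finRotate u (b + 1 + j)) '' (Finset.range (s + 1) : Set ℕ) ⊆
      (circulantFar b s).neighborSet u := by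
    rintro _ ⟨j, hj, rfl⟩
    simp only [Finset.coe_range, Set.mem_Iio] at hj
    rw [mem_neighborSet]
    nth_rewrite 1 [← finRotate_zero u]
    rw [circulantFar_adj_finRotate u (by omega) (by omega)]
    omega
  calc s + 1 = ((Finset.range (s + 1) : Set ℕ)).ncard := by simp
    _ = _ := hinj.ncard_image.symm
    _ ≤ _ := Set.ncard_le_ncard hsub (Set.toFinite _)

theorem circulantFar_walk_displacement {b s : ℕ} {u v : Fin (2 * b + s + 2)}
    (w : (circulantFar b s).Walk u v) :
    ∃ t : ℤ, |2 * ((v : ℤ) - u) - (w.length + 2 * t) * (2 * b + s + 2)| ≤ w.length * s := by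
  induction w with
  | nil => exact ⟨0, by simp⟩
  | @cons a c d h p ih =>
    obtain ⟨t, ht⟩ := ih
    rw [circulantFar_adj] at h
    rw [abs_le] at ht
    rcases h with h | h
    · refine ⟨t - 1, ?_⟩
      rw [abs_le, Walk.length_cons]
      push_cast
      constructor <;> linarith
    · refine ⟨t, ?_⟩
      rw [abs_le, Walk.length_cons]
      push_cast
      constructor <;> linarith

theorem not_hasCycleOfLength_circulantFar (j s : ℕ) :
    ¬ HasCycleOfLength (circulantFar (j * s) s) (2 * j + 1) := by
  rintro ⟨v, w, -, hw⟩
  obtain ⟨t, ht⟩ := circulantFar_walk_displacement w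
  rw [hw, sub_self, mul_zero, zero_sub, abs_neg, abs_mul] at ht
  push_cast at ht
  have h1 : (1 : ℤ) ≤ |2 * (j : ℤ) + 1 + 2 * t| := Int.one_le_abs (by omega)
  have h2 : (0 : ℤ) < 2 * (j * s) + s + 2 := by positivity
  rw [abs_of_pos h2] at ht
  nlinarith

/-- Two interlaced sequences, the second one shifted by `b + 1`, form a path of `circulantFar`. -/
theorem circulantFar_hasCycleOfLength_of_interlaced {b s j x : ℕ} (u : Fin (2 * b + s + 2))
    (E O : ℕ → ℕ) (hx : 1 ≤ x) (hxb : x ≤ b) (hE0 : E 0 = 0) (hEj : E j = x)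
    (hE : Set.InjOn E (Set.Iic j)) (hO : Set.InjOn O (Set.Iio j))
    (hEb : ∀ i ≤ j, E i ≤ b) (hOb : ∀ i < j, O i ≤ b + s)
    (h₁ : ∀ i < j, E i ≤ O i ∧ O i ≤ E i + s)
    (h₂ : ∀ i < j, E (i + 1) ≤ O i ∧ O i ≤ E (i + 1) + s) :
    HasCycleOfLength (circulantFar b s ⊔ fromEdgeSet {s(u, finRotate u x)}) (2 * j + 1) := by
  set g : ℕ → ℕ := fun t => if t % 2 = 0 then E (t / 2) else b + 1 + O (t / 2) with hg
  have hg0 : ∀ i, g (2 * i) = E i := fun i => by simp [hg]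
  have hg1 : ∀ i, g (2 * i + 1) = b + 1 + O i := fun i => by
    simp [hg, Nat.add_mod, show (2 * i + 1) / 2 = i by omega]
  have hcases : ∀ t, ∃ i, t = 2 * i ∨ t = 2 * i + 1 := fun t => ⟨t / 2, by omega⟩
  have hgN : ∀ t ≤ 2 * j, g t < 2 * b + s + 2 := by
    intro t ht
    obtain ⟨i, rfl | rfl⟩ := hcases t
    · have := hEb i (by omega)
      rw [hg0]; omega
    · have := hOb i (by omega)
      rw [hg1]; omega
  refine hasCycleOfLength_sup_of_path (fun t => finRotate u (g t)) ?_ ?_ ?_ ?_ ?_ ?_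
  · intro t ht
    rw [circulantFar_adj_finRotate u (hgN t ht.le) (hgN (t + 1) ht)]
    obtain ⟨i, rfl | rfl⟩ := hcases t
    · have := h₁ i (by omega)
      rw [hg0, hg1]; omega
    · have := h₂ i (by omega)
      rw [hg1, show 2 * i + 1 + 1 = 2 * (i + 1) by ring, hg0]; omega
  · intro t ht t' ht' h
    rw [Set.mem_Iic] at ht ht'
    have h' := finRotate_injOn u (Set.mem_Iio.mpr (hgN t ht)) (Set.mem_Iio.mpr (hgN t' ht')) h
    obtain ⟨i, rfl | rfl⟩ := hcases t <;> obtain ⟨i', rfl | rfl⟩ := hcases t'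
    · rw [hg0, hg0] at h'
      rw [hE (Set.mem_Iic.mpr (by omega)) (Set.mem_Iic.mpr (by omega)) h']
    · have := hEb i (by omega)
      rw [hg0, hg1] at h'; omega
    · have := hEb i' (by omega)
      rw [hg0, hg1] at h'; omega
    · rw [hg1, hg1] at h'
      rw [hO (Set.mem_Iio.mpr (by omega)) (Set.mem_Iio.mpr (by omega)) (Nat.add_left_cancel h')]
  · have := hg0 0
    simp only [mul_zero] at this
    simp only [this, hE0, finRotate_zero]
  · simp only [hg0, hEj]
  · intro h
    nth_rewrite 1 [← finRotate_zero u] at h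
    have := finRotate_injOn u (Set.mem_Iio.mpr (by omega)) (Set.mem_Iio.mpr (by omega)) h
    omega
  · nth_rewrite 1 [← finRotate_zero u]
    rw [circulantFar_adj_finRotate u (by omega) (by omega)]
    omega

theorem circulantFar_hasCycleOfLength_of_le {j s x : ℕ} (u : Fin (2 * (j * s) + s + 2))
    (hx : 1 ≤ x) (hxb : x ≤ j * s) (hjx : j ≤ x) :
    HasCycleOfLength (circulantFar (j * s) s ⊔ fromEdgeSet {s(u, finRotate u x)})
      (2 * j + 1) := by
  have hs : 1 ≤ s := Nat.pos_of_ne_zero fun h => by simp [h] at hxb; omega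
  set E : ℕ → ℕ := fun i => min (i * s) (x - j + i) with hE
  have hstep : ∀ i, E i + 1 ≤ E (i + 1) ∧ E (i + 1) ≤ E i + s := fun i => by
    simp only [hE, add_mul, one_mul]; omega
  have hmono : StrictMono E := strictMono_nat_of_lt_succ fun i => (hstep i).1
  have hEj : E j = x := by simp only [hE]; omega
  have hle : ∀ i ≤ j, E i ≤ j * s := fun i hi =>
    (hmono.monotone hi).trans (hEj.le.trans hxb)
  refine circulantFar_hasCycleOfLength_of_interlaced u E (fun i => E (i + 1)) hx hxb
    (by simp [hE]) hEj hmono.injective.injOn ?_ hle ?_ ?_ ?_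
  · intro i _ i' _ h
    have := hmono.injective h
    omega
  · intro i hi
    have := hle (i + 1) hi
    change E (i + 1) ≤ _
    omega
  · intro i _
    have := hstep i
    change E i ≤ E (i + 1) ∧ E (i + 1) ≤ _
    omega
  · intro i _
    omega

/-- Visits `0, …, j` with steps of size at most two: it climbs to `x - 1`, skips `x`, goes up to `j`
and returns to `x`. -/
def zigzag (j x i : ℕ) : ℕ :=
  if i < x then i
  else if 2 * (i - x) + 1 ≤ j - x then x + 2 * (i - x) + 1
  else x + 2 * (j - i)

/-- A number within two above both `zigzag j x i` and `zigzag j x (i + 1)`. -/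
def zigzagMid (j x i : ℕ) : ℕ :=
  if i + 1 ≤ x ∨ 2 * (i + 1 - x) + 1 ≤ j - x then zigzag j x (i + 1)
  else if 2 * (i - x) + 1 ≤ j - x then j + 1
  else zigzag j x i

theorem circulantFar_hasCycleOfLength_of_lt {j s x : ℕ} (u : Fin (2 * (j * s) + s + 2))
    (hx : 1 ≤ x) (hs : 2 ≤ s) (hxj : x < j) :
    HasCycleOfLength (circulantFar (j * s) s ⊔ fromEdgeSet {s(u, finRotate u x)})
      (2 * j + 1) := by
  have hjs : j * 2 ≤ j * s := Nat.mul_le_mul_left j hs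
  refine circulantFar_hasCycleOfLength_of_interlaced u (zigzag j x) (zigzagMid j x) hx (by omega)
    ?_ ?_ ?_ ?_ ?_ ?_ ?_ ?_
  · simp only [zigzag]; split_ifs <;> omega
  · simp only [zigzag]; split_ifs <;> omega
  · intro i hi i' hi' h
    rw [Set.mem_Iic] at hi hi'
    simp only [zigzag] at h
    split_ifs at h <;> omega
  · intro i hi i' hi' h
    rw [Set.mem_Iio] at hi hi'
    simp only [zigzagMid, zigzag] at h
    split_ifs at h <;> omega
  · intro i hi
    simp only [zigzag]; split_ifs <;> omega
  all_goals
    intro i hi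
    simp only [zigzagMid, zigzag]
    split_ifs <;> omega

theorem maximalCLFree_circulantFar {j s : ℕ} (h : 2 ≤ s ∨ j ≤ 1 ∨ s = 0) :
    MaximalCLFree (circulantFar (j * s) s) (2 * j + 1) := by
  refine ⟨not_hasCycleOfLength_circulantFar j s, fun u v huv hn => ?_⟩
  have key : ∀ (a : Fin (2 * (j * s) + s + 2)) (x : ℕ), 1 ≤ x → x ≤ j * s →
      HasCycleOfLength (circulantFar (j * s) s ⊔ fromEdgeSet {s(a, finRotate a x)})
        (2 * j + 1) := by
    intro a x hx hxb
    rcases le_or_gt j x with hjx | hjx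
    · exact circulantFar_hasCycleOfLength_of_le a hx hxb hjx
    · rcases h with hs | hj | rfl
      · exact circulantFar_hasCycleOfLength_of_lt a hx hs hjx
      · omega
      · omega
  obtain ⟨x, hx, hxb, rfl | rfl⟩ := exists_finRotate_eq_of_not_adj huv hn
  · exact key u x hx hxb
  · exact hasCycleOfLength_sup_swap (key v x hx hxb)

/-- The union of the cliques `{0, …, c}` and `{c, …, c + 3}`, which share the vertex `c`. -/
def twoCliques (c : ℕ) : SimpleGraph (Fin (c + 4)) where
  Adj u v := u ≠ v ∧ (((u : ℕ) ≤ c ∧ (v : ℕ) ≤ c) ∨ (c ≤ (u : ℕ) ∧ c ≤ (v : ℕ)))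
  symm := ⟨fun _ _ h => ⟨h.1.symm, by tauto⟩⟩
  loopless := ⟨fun _ h => h.1 rfl⟩

theorem twoCliques_adj {c : ℕ} {u v : Fin (c + 4)} :
    (twoCliques c).Adj u v ↔
      (u : ℕ) ≠ v ∧ (((u : ℕ) ≤ c ∧ (v : ℕ) ≤ c) ∨ (c ≤ (u : ℕ) ∧ c ≤ (v : ℕ))) := by
  simp [twoCliques, Fin.ext_iff]

theorem mem_support_twoCliques {c : ℕ} {u v z : Fin (c + 4)} (hz : (z : ℕ) = c)
    (w : (twoCliques c).Walk u v) (hu : (u : ℕ) ≤ c) (hv : c ≤ (v : ℕ)) : z ∈ w.support := by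
  induction w with
  | nil => simpa using Fin.ext (by omega)
  | @cons a d e h p ih =>
    rw [Walk.support_cons, List.mem_cons]
    rw [twoCliques_adj] at h
    by_cases hd : (d : ℕ) ≤ c
    · exact .inr (ih hd hv)
    · exact .inl (Fin.ext (by omega))

theorem not_hasCycleOfLength_twoCliques {c : ℕ} (hc : 3 ≤ c) :
    ¬ HasCycleOfLength (twoCliques c) (c + 2) := by
  rintro ⟨v, w, hw, hlen⟩
  have hcard : w.support.tail.toFinset.card = c + 2 := by
    rw [List.toFinset_card_of_nodup hw.support_nodup, List.length_tail, Walk.length_support, hlen]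
    omega
  have hex : ∀ P : Fin (c + 4) → Prop, ∀ [DecidablePred P],
      (Finset.univ.filter P).card ≤ c + 1 → ∃ y ∈ w.support, ¬ P y := by
    intro P _ hP
    by_contra! hcon
    have : w.support.tail.toFinset ⊆ Finset.univ.filter P := fun y hy => by
      simpa using hcon y (List.mem_of_mem_tail (List.mem_toFinset.mp hy))
    have := Finset.card_le_card this
    omega
  obtain ⟨y, hy, hyc⟩ := hex (fun y => (y : ℕ) ≤ c) <| by
    have : (Finset.univ.filter fun y : Fin (c + 4) => (y : ℕ) ≤ c).card ≤
        (Finset.range (c + 1)).card :=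
      Finset.card_le_card_of_injOn Fin.val (fun a ha => by simp at ha ⊢; omega)
        Fin.val_injective.injOn
    simpa using this
  obtain ⟨x, hx, hxc⟩ := hex (fun y => c ≤ (y : ℕ)) <| by
    have : (Finset.univ.filter fun y : Fin (c + 4) => c ≤ (y : ℕ)).card ≤
        (Finset.Ico c (c + 4)).card :=
      Finset.card_le_card_of_injOn Fin.val (fun a ha => by simp at ha ⊢; omega)
        Fin.val_injective.injOn
    simp at this
    omega
  have hw' := hw.rotate hx
  have hy' : y ∈ (w.rotate x hx).support := by
    rwa [Walk.mem_support_rotate_iff]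
  set w' := w.rotate x hx
  let z : Fin (c + 4) := ⟨c, by omega⟩
  have hnd := hw'.support_nodup
  rw [← w'.take_spec hy', Walk.tail_support_append] at hnd
  have h₁ : z ∈ (w'.takeUntil y hy').support := mem_support_twoCliques rfl _ (by omega) (by omega)
  have h₂ : z ∈ (w'.dropUntil y hy').support := by
    have := mem_support_twoCliques (z := z) rfl (w'.dropUntil y hy').reverse (by omega) (by omega)
    simpa using this
  have hzx : z ≠ x := fun h => hxc (le_of_eq (congrArg Fin.val h))
  have hzy : z ≠ y := fun h => hyc (le_of_eq (congrArg Fin.val h).symm)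
  rw [Walk.mem_support_iff] at h₁ h₂
  exact (List.nodup_append.mp hnd).2.2 z (h₁.resolve_left hzx) z (h₂.resolve_left hzy) rfl

theorem maximalCLFree_twoCliques {c : ℕ} (hc : 3 ≤ c) :
    MaximalCLFree (twoCliques c) (c + 2) := by
  refine ⟨not_hasCycleOfLength_twoCliques hc, ?_⟩
  have key : ∀ u v : Fin (c + 4), (u : ℕ) < c → c < (v : ℕ) →
      HasCycleOfLength (twoCliques c ⊔ fromEdgeSet {s(u, v)}) (c + 2) := by
    intro u v hu hv
    have hvlt := v.isLt
    let g : ℕ → ℕ := fun t =>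
      if t = 0 then (u : ℕ) else if t ≤ (u : ℕ) then t - 1 else if t ≤ c then t else (v : ℕ)
    have hg : ∀ t, g t < c + 4 := fun t => by
      simp only [g]; split_ifs <;> omega
    refine hasCycleOfLength_sup_of_path (n := c + 1) (fun t => ⟨g t, hg t⟩) ?_ ?_ ?_ ?_ ?_ ?_
    · intro t ht
      rw [twoCliques_adj]
      change g t ≠ g (t + 1) ∧ ((g t ≤ c ∧ g (t + 1) ≤ c) ∨ (c ≤ g t ∧ c ≤ g (t + 1)))
      simp only [g]
      split_ifs <;> first | contradiction | omega
    · intro t ht t' ht' h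
      rw [Set.mem_Iic] at ht ht'
      have h' := congrArg Fin.val h
      simp only [g] at h'
      split_ifs at h' <;> omega
    · simp [g]
    · apply Fin.ext
      change g (c + 1) = v
      simp only [g]
      split_ifs <;> first | contradiction | omega
    · intro h
      rw [h] at hu
      omega
    · rw [twoCliques_adj]
      omega
  intro u v huv hn
  have huv' : (u : ℕ) ≠ v := fun e => huv (Fin.ext e)
  rw [twoCliques_adj] at hn
  rcases lt_or_gt_of_ne huv' with h | h
  · exact key u v (by omega) (by omega)
  · exact hasCycleOfLength_sup_swap (key v u (by omega) (by omega))

theorem two_le_ncard_neighborSet_twoCliques {c : ℕ} (hc : 3 ≤ c) (u : Fin (c + 4)) :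
    2 ≤ ((twoCliques c).neighborSet u).ncard := by
  have hlt := u.isLt
  obtain ⟨x, y, hx, hy, hxy, hux, huy⟩ : ∃ x y : ℕ, ∃ (hx : x < c + 4) (hy : y < c + 4), x ≠ y ∧
      (twoCliques c).Adj u ⟨x, hx⟩ ∧ (twoCliques c).Adj u ⟨y, hy⟩ := by
    simp only [twoCliques_adj]
    by_cases h : (u : ℕ) ≤ c
    · by_cases h0 : (u : ℕ) = 0
      · exact ⟨1, 2, by omega, by omega, by omega, by omega, by omega⟩
      · by_cases h1 : (u : ℕ) = 1
        · exact ⟨0, 2, by omega, by omega, by omega, by omega, by omega⟩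
        · exact ⟨0, 1, by omega, by omega, by omega, by omega, by omega⟩
    · by_cases h1 : (u : ℕ) = c + 1
      · exact ⟨c, c + 2, by omega, by omega, by omega, by omega, by omega⟩
      · exact ⟨c, c + 1, by omega, by omega, by omega, by omega, by omega⟩
  rw [← Set.ncard_pair (a := (⟨x, hx⟩ : Fin (c + 4))) (b := ⟨y, hy⟩) (by simpa using hxy)]
  exact Set.ncard_le_ncard (Set.insert_subset hux (Set.singleton_subset_iff.mpr huy))
    (Set.toFinite _)

theorem twoCliques_neighborSet_injective {c : ℕ} (hc : 3 ≤ c) {u v : Fin (c + 4)} (huv : u ≠ v) :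
    (twoCliques c).neighborSet u ≠ (twoCliques c).neighborSet v := by
  intro heq
  have huv' : (u : ℕ) ≠ v := fun e => huv (Fin.ext e)
  have hiff : ∀ w, (twoCliques c).Adj u w ↔ (twoCliques c).Adj v w := fun w =>
    Set.ext_iff.mp heq w
  have hu := hiff u
  have h0 := hiff ⟨0, by omega⟩
  have h1 := hiff ⟨1, by omega⟩
  simp only [twoCliques_adj] at hu h0 h1
  omega

end SimpleGraph

/-- Lower bound of Theorem 1.3: for `k ≥ 2` and `r ≥ 1` there is a maximal
`C_{2k−1}`-free graph on `N = (2k−1)(r−1)+2` vertices with minimum degree at least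
`N/(2k−1)` in which distinct vertices have distinct neighborhoods. -/
theorem blowup_threshold_lower (k r : ℕ) (hk : 2 ≤ k) (hr : 1 ≤ r) :
    ∃ (V : Type) (_ : Finite V) (G : SimpleGraph V),
      Nat.card V = (2 * k - 1) * (r - 1) + 2 ∧
      MaximalCLFree G (2 * k - 1) ∧
      (∀ v : V,
        (((2 * k - 1) * (r - 1) + 2 : ℕ) : ℝ) / (2 * (k : ℝ) - 1) ≤
          (G.neighborSet v).ncard) ∧
      (∀ u v : V, u ≠ v → G.neighborSet u ≠ G.neighborSet v) := by
  obtain ⟨j, rfl⟩ : ∃ j, k = j + 1 := ⟨k - 1, by omega⟩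
  obtain ⟨s, rfl⟩ : ∃ s, r = s + 1 := ⟨r - 1, by omega⟩
  have hℓ : 2 * (j + 1) - 1 = 2 * j + 1 := by omega
  have hdeg : (((2 * j + 1) * s + 2 : ℕ) : ℝ) / (2 * ((j + 1 : ℕ) : ℝ) - 1) ≤
      ((s + 1 : ℕ) : ℝ) := by
    have hj : (1 : ℝ) ≤ j := by exact_mod_cast (by omega : 1 ≤ j)
    rw [div_le_iff₀ (by push_cast; linarith)]
    push_cast
    nlinarith
  simp only [hℓ, Nat.add_sub_cancel]
  by_cases h : 2 ≤ s ∨ j ≤ 1 ∨ s = 0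
  · refine ⟨Fin (2 * (j * s) + s + 2), inferInstance, circulantFar (j * s) s, ?_,
      maximalCLFree_circulantFar h, fun v => hdeg.trans ?_,
      fun u v => circulantFar_neighborSet_injective⟩
    · rw [Nat.card_fin]; ring
    · exact_mod_cast succ_le_ncard_neighborSet_circulantFar v
  · obtain rfl : s = 1 := by omega
    obtain ⟨c, hc⟩ : ∃ c, 2 * j + 1 = c + 2 := ⟨2 * j - 1, by omega⟩
    have hc3 : 3 ≤ c := by omega
    refine ⟨Fin (c + 4), inferInstance, twoCliques c, ?_, ?_, fun v => hdeg.trans ?_,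
      fun u v => twoCliques_neighborSet_injective hc3⟩
    · rw [Nat.card_fin]; omega
    · rw [hc]
      exact maximalCLFree_twoCliques hc3
    · exact_mod_cast two_le_ncard_neighborSet_twoCliques hc3 v
end

section
/- Theorem 1.4: Let r, s ≥ 3 be integers and set t = r + s − 3. Let G be an n-vertex finite simple graph with minimum degree δ(G) ≥ (((s−3)(r−1)+1)/((s−2)(r−1)+1))·n, and let v: V(G) → 𝔽_2^t be an assignment of binary vectors of length t to the vertices. Suppose that for every set {x_1, …, x_{s−2}} of s−2 vertices forming a clique in G, the number of indices j ∈ {1,…,t} with v(x_1)_j = v(x_2)_j = ⋯ = v(x_{s−2})_j = 1 is at most 1. Then Σ_{x ∈ V(G)} ‖v(x)‖ ≤ (((s−3)(r−1)+1)/((s−2)(r−1)+1))·t·n, where ‖v(x)‖ denotes the number of coordinates of v(x) equal to 1. -/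
open SimpleGraph Finset

/-- The number of coordinates of a binary vector equal to `1`. -/
def weight {t : ℕ} (w : Fin t → ZMod 2) : ℕ :=
  (Finset.univ.filter fun j : Fin t => w j = 1).card

/-- Greedy choice of a clique by decreasing weight: if every vertex has at most `B` non-neighbours
(itself included) and `U` has more than `i * B` vertices, then some clique `insert z S` in `U` with
`S.card = i` controls the total weight of `U`. -/
theorem exists_clique_sum_le {V : Type*} [Fintype V] [DecidableEq V] (G : SimpleGraph V)
    [DecidableRel G.Adj] (f : V → ℝ) (B : ℝ) (hB0 : 0 ≤ B)
    (hB : ∀ x : V, ((univ.filter fun y => ¬ G.Adj x y).card : ℝ) ≤ B) (i : ℕ) :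
    ∀ U : Finset V, (i : ℝ) * B < U.card →
      ∃ (S : Finset V) (z : V), S ⊆ U ∧ z ∈ U ∧ z ∉ S ∧ S.card = i ∧
        G.IsClique (insert z S : Finset V) ∧
        ∑ y ∈ U, f y ≤ B * ∑ y ∈ S, f y + (U.card - i * B) * f z := by
  induction i with
  | zero =>
    intro U hU
    have hne : U.Nonempty := by
      rw [← Finset.card_pos]
      simpa using hU
    obtain ⟨z, hz, hmax⟩ := U.exists_max_image f hne
    refine ⟨∅, z, by simp, hz, by simp, rfl, by simp, ?_⟩
    have := Finset.sum_le_card_nsmul U f (f z) hmax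
    simpa using this
  | succ i ih =>
    intro U hU
    have hne : U.Nonempty := by
      rw [← Finset.card_pos]
      exact_mod_cast lt_of_le_of_lt (by positivity : (0 : ℝ) ≤ ((i + 1 : ℕ) : ℝ) * B) hU
    obtain ⟨x, hx, hmax⟩ := U.exists_max_image f hne
    have hsplit := Finset.card_filter_add_card_filter_not (s := U) (G.Adj x)
    have hout : ((U.filter fun y => ¬ G.Adj x y).card : ℝ) ≤ B :=
      (Nat.cast_le.2 (Finset.card_le_card
        (Finset.filter_subset_filter _ (Finset.subset_univ U)))).trans (hB x)
    have hsplit' : ((U.filter fun y => G.Adj x y).card : ℝ)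
        + (U.filter fun y => ¬ G.Adj x y).card = U.card := by exact_mod_cast hsplit
    push_cast at hU
    obtain ⟨S, z, hS, hz, hzS, hcard, hclique, hsum⟩ :=
      ih (U.filter fun y => G.Adj x y) (by linarith)
    have hadj : ∀ y ∈ insert z S, G.Adj x y := by
      intro y hy
      rcases Finset.mem_insert.1 hy with rfl | hy
      · exact (Finset.mem_filter.1 hz).2
      · exact (Finset.mem_filter.1 (hS hy)).2
    have hxS : x ∉ S := fun h => G.irrefl (hadj x (Finset.mem_insert_of_mem h))
    have hzx : z ≠ x := fun h => G.irrefl (h ▸ hadj z (Finset.mem_insert_self z S))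
    refine ⟨insert x S, z, ?_, (Finset.mem_filter.1 hz).1, by simp [hzx, hzS],
      by rw [Finset.card_insert_of_notMem hxS, hcard], ?_, ?_⟩
    · exact Finset.insert_subset hx (hS.trans (Finset.filter_subset _ _))
    · rw [Finset.insert_comm, Finset.coe_insert]
      exact hclique.insert fun y hy _ => hadj y (by exact_mod_cast hy)
    · rw [Finset.sum_insert hxS,
        ← Finset.sum_filter_add_sum_filter_not U (fun y => G.Adj x y) f]
      have h1 := Finset.sum_le_card_nsmul (U.filter fun y => ¬ G.Adj x y) f (f x)
        fun y hy => hmax y (Finset.mem_filter.1 hy).1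
      rw [nsmul_eq_mul] at h1
      have h2 := mul_nonneg (sub_nonneg.2 hout)
        (sub_nonneg.2 (hmax z (Finset.mem_filter.1 hz).1))
      push_cast
      rw [← hsplit']
      nlinarith

/-- The total weight on `S`, counted coordinate by coordinate. -/
theorem sum_weight_eq {V : Type*} {t : ℕ} (v : V → Fin t → ZMod 2) (S : Finset V) :
    ∑ x ∈ S, weight (v x) = ∑ j : Fin t, (S.filter fun x => v x j = 1).card := by
  simp only [weight, Finset.card_filter]
  exact Finset.sum_comm

/-- If at most one coordinate is `1` on all of `S`, then all others have at most `k = S.card - 1`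
ones on `S`. -/
theorem sum_weight_le_of_card_eq {V : Type*} {t k : ℕ} (v : V → Fin t → ZMod 2) (S : Finset V)
    (hcard : S.card = k + 1)
    (hS : (univ.filter fun j : Fin t => ∀ x ∈ S, v x j = 1).card ≤ 1) :
    ∑ x ∈ S, weight (v x) ≤ k * t + 1 := by
  rw [sum_weight_eq]
  calc ∑ j : Fin t, (S.filter fun x => v x j = 1).card
      ≤ ∑ j : Fin t, (k + if ∀ x ∈ S, v x j = 1 then 1 else 0) := by
        refine Finset.sum_le_sum fun j _ => ?_
        split_ifs with h
        · exact (Finset.card_filter_le _ _).trans hcard.le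
        · push Not at h
          have := Finset.card_lt_card (Finset.filter_ssubset.2 h)
          omega
    _ = k * t + (univ.filter fun j : Fin t => ∀ x ∈ S, v x j = 1).card := by
        rw [Finset.sum_add_distrib, ← Finset.card_filter]
        simp [mul_comm]
    _ ≤ k * t + 1 := by omega

/-- Weight bound when deleting any vertex of `S` leaves at most one coordinate that is `1`
everywhere. -/
theorem sum_weight_le_of_erase {V : Type*} [DecidableEq V] {t k : ℕ} (v : V → Fin t → ZMod 2)
    (S : Finset V) (hcard : S.card = k + 2)
    (hS : ∀ y ∈ S, (univ.filter fun j : Fin t => ∀ x ∈ S.erase y, v x j = 1).card ≤ 1) :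
    ∑ x ∈ S, weight (v x) ≤ k * t + (k + 2) := by
  have hcoord : ∀ j : Fin t, (S.filter fun x => v x j = 1).card
      ≤ k + (S.filter fun y => ∀ x ∈ S.erase y, v x j = 1).card := by
    intro j
    have hsplit := Finset.card_filter_add_card_filter_not (s := S) (fun x => v x j = 1)
    rcases Nat.lt_or_ge (S.filter fun x => ¬ v x j = 1).card 2 with hlt | hge
    · rcases Nat.lt_or_ge (S.filter fun x => ¬ v x j = 1).card 1 with h0 | h1
      · have he : S.filter (fun x => ¬ v x j = 1) = ∅ := Finset.card_eq_zero.1 (by omega)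
        have hall : ∀ x ∈ S, v x j = 1 := by
          simpa using Finset.filter_eq_empty_iff.1 he
        rw [Finset.filter_true_of_mem (s := S) (p := fun y => ∀ x ∈ S.erase y, v x j = 1)
          fun y _ x hx => hall x (Finset.mem_of_mem_erase hx)]
        have := Finset.card_filter_le S fun x => v x j = 1
        omega
      · obtain ⟨y, hy⟩ := Finset.card_eq_one.1 (le_antisymm (Nat.le_of_lt_succ hlt) h1)
        have hyS : y ∈ S := (Finset.mem_filter.1 (hy ▸ Finset.mem_singleton_self y)).1
        have hmem : y ∈ S.filter fun y => ∀ x ∈ S.erase y, v x j = 1 := by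
          refine Finset.mem_filter.2 ⟨hyS, fun x hx => ?_⟩
          by_contra hne
          have : x ∈ S.filter fun x => ¬ v x j = 1 :=
            Finset.mem_filter.2 ⟨Finset.mem_of_mem_erase hx, hne⟩
          rw [hy, Finset.mem_singleton] at this
          exact Finset.ne_of_mem_erase hx this
        have := Finset.card_pos.2 ⟨y, hmem⟩
        omega
    · omega
  have hdouble : ∑ j : Fin t, (S.filter fun y => ∀ x ∈ S.erase y, v x j = 1).card ≤ k + 2 := by
    calc ∑ j : Fin t, (S.filter fun y => ∀ x ∈ S.erase y, v x j = 1).card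
        = ∑ y ∈ S, (univ.filter fun j : Fin t => ∀ x ∈ S.erase y, v x j = 1).card := by
          simp only [Finset.card_filter]
          exact Finset.sum_comm
      _ ≤ k + 2 := by simpa [hcard] using Finset.sum_le_card_nsmul S _ 1 hS
  rw [sum_weight_eq]
  calc ∑ j : Fin t, (S.filter fun x => v x j = 1).card
      ≤ ∑ j : Fin t, (k + (S.filter fun y => ∀ x ∈ S.erase y, v x j = 1).card) :=
        Finset.sum_le_sum fun j _ => hcoord j
    _ ≤ k * t + (k + 2) := by
        rw [Finset.sum_add_distrib]
        simpa [mul_comm] using hdouble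

/-- Theorem 1.4: let `r, s ≥ 3`, `t = r + s − 3`, and let `G` be an `n`-vertex graph
with minimum degree at least `((s−3)(r−1)+1)/((s−2)(r−1)+1)·n`. If
`v : V(G) → 𝔽₂^t` is such that for every clique on `s−2` vertices at most one
coordinate is `1` on all of them, then `Σ_x ‖v(x)‖ ≤ ((s−3)(r−1)+1)/((s−2)(r−1)+1)·t·n`. -/
theorem codes_on_graphs (r s : ℕ) (hr : 3 ≤ r) (hs : 3 ≤ s)
    (V : Type) [Fintype V] (G : SimpleGraph V)
    (v : V → Fin (r + s - 3) → ZMod 2)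
    (hδ : ∀ x : V,
      ((((s : ℝ) - 3) * ((r : ℝ) - 1) + 1) / (((s : ℝ) - 2) * ((r : ℝ) - 1) + 1)) *
          (Nat.card V) ≤ (G.neighborSet x).ncard)
    (hcode : ∀ S : Finset V, S.card = s - 2 → G.IsClique (S : Set V) →
      (Finset.univ.filter fun j : Fin (r + s - 3) => ∀ x ∈ S, v x j = 1).card ≤ 1) :
    (∑ x : V, (weight (v x) : ℝ)) ≤
      ((((s : ℝ) - 3) * ((r : ℝ) - 1) + 1) / (((s : ℝ) - 2) * ((r : ℝ) - 1) + 1)) *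
        ((r + s - 3 : ℕ) : ℝ) * (Nat.card V) := by
  classical
  obtain ⟨k, rfl⟩ : ∃ k, s = k + 3 := ⟨s - 3, by omega⟩
  obtain ⟨m, rfl⟩ : ∃ m, r = m + 1 := ⟨r - 1, by omega⟩
  have ht : ((m + 1 + (k + 3) - 3 : ℕ) : ℝ) = m + k + 1 := by
    rw [show m + 1 + (k + 3) - 3 = m + k + 1 by omega]
    push_cast
    ring
  have hm : (1 : ℝ) ≤ m := by exact_mod_cast (by omega : 1 ≤ m)
  have hnum : (((k + 3 : ℕ) : ℝ) - 3) * (((m + 1 : ℕ) : ℝ) - 1) + 1 = k * m + 1 := by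
    push_cast
    ring
  have hden : (((k + 3 : ℕ) : ℝ) - 2) * (((m + 1 : ℕ) : ℝ) - 1) + 1 = (k + 1) * m + 1 := by
    push_cast
    ring
  rw [hnum, hden] at hδ ⊢
  rw [Nat.card_eq_fintype_card] at hδ ⊢
  set n : ℝ := (Fintype.card V : ℝ) with hn
  have hD : (0 : ℝ) < (k + 1) * m + 1 := by positivity
  rcases isEmpty_or_nonempty V with hV | hV
  · simp [hn]
  have hnpos : 0 < n := by
    rw [hn]
    exact_mod_cast Fintype.card_pos
  have hB : ∀ x : V, ((univ.filter fun y => ¬ G.Adj x y).card : ℝ)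
      ≤ m * n / ((k + 1) * m + 1) := by
    intro x
    have hdeg : (G.neighborSet x).ncard = (univ.filter fun y => G.Adj x y).card := by
      rw [← Set.ncard_coe_finset]
      congr 1
      ext y
      simp
    have hsplit : ((univ.filter fun y => G.Adj x y).card : ℝ)
        + (univ.filter fun y => ¬ G.Adj x y).card = n := by
      rw [hn, ← Finset.card_univ]
      exact_mod_cast Finset.card_filter_add_card_filter_not (s := univ) (G.Adj x)
    have hx := hδ x
    rw [hdeg] at hx
    have : (k * m + 1) / ((k + 1) * m + 1) * n + m * n / ((k + 1) * m + 1) = n := by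
      field_simp
      ring
    linarith
  have hrest : n - ((k + 1 : ℕ) : ℝ) * (m * n / ((k + 1) * m + 1)) = n / ((k + 1) * m + 1) := by
    push_cast
    field_simp
    ring
  have hrest_pos : 0 < n / ((k + 1) * m + 1) := by positivity
  obtain ⟨S, z, -, -, hzS, hcard, hclique, hsum⟩ :=
    exists_clique_sum_le G (fun x => (weight (v x) : ℝ)) (m * n / ((k + 1) * m + 1))
      (by positivity) hB (k + 1) univ (by rw [Finset.card_univ]; linarith)
  rw [Finset.card_univ, ← hn, hrest] at hsum
  have hsmall : ∑ x ∈ S, (weight (v x) : ℝ) ≤ k * (m + k + 1) + 1 := by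
    have := sum_weight_le_of_card_eq v S hcard
      (hcode S hcard (hclique.subset (by simp)))
    rw [← ht]
    exact_mod_cast this
  have hlarge : ∑ x ∈ S, (weight (v x) : ℝ) + weight (v z) ≤ k * (m + k + 1) + (k + 2) := by
    have hcard' : (insert z S).card = k + 2 := by
      rw [Finset.card_insert_of_notMem hzS, hcard]
    have := sum_weight_le_of_erase v (insert z S) hcard' fun y hy =>
      hcode _ (by rw [Finset.card_erase_of_mem hy, hcard']; rfl)
        (hclique.subset (by exact_mod_cast Finset.erase_subset _ _))
    rw [Finset.sum_insert hzS, add_comm] at this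
    rw [← ht]
    exact_mod_cast this
  rw [ht]
  calc ∑ x : V, (weight (v x) : ℝ)
      ≤ m * n / ((k + 1) * m + 1) * ∑ x ∈ S, (weight (v x) : ℝ)
        + n / ((k + 1) * m + 1) * weight (v z) := hsum
    _ = n / ((k + 1) * m + 1) * ((m - 1) * ∑ x ∈ S, (weight (v x) : ℝ)
        + (∑ x ∈ S, (weight (v x) : ℝ) + weight (v z))) := by ring
    _ ≤ n / ((k + 1) * m + 1) * ((m - 1) * (k * (m + k + 1) + 1)
        + (k * (m + k + 1) + (k + 2))) := by
        have : (0 : ℝ) ≤ m - 1 := by linarith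
        gcongr
    _ = (k * m + 1) / ((k + 1) * m + 1) * (m + k + 1) * n := by ring
end

section
/- Claim 3.3 (common neighbors have small weight): Let r, s ≥ 3 be integers and set t = r + s − 3. Let G be a finite simple graph and let v: V(G) → 𝔽_2^t satisfy: for every set of s−2 vertices forming a clique in G, the number of indices j ∈ {1,…,t} at which all of their vectors have coordinate 1 is at most 1. Suppose x_0, x_1, …, x_{s−3} are vertices of G forming a clique on s−2 vertices with Σ_{j=0}^{s−3} ‖v(x_j)‖ = 1 + t(s−3). Then every vertex w lying in the common neighborhood ∩_{0 ≤ h ≤ s−3} N_G(x_h) satisfies ‖v(w)‖ ≤ s − 2. -/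
open SimpleGraph Finset

/-- If at most one row of a boolean `t × m` array is full and the array has at least
`1 + t(m-1)` true entries, then every row has at most one false entry. -/
theorem exists_forall_ne_of_sum_card {ι κ : Type*} [Fintype ι] [Fintype κ] [DecidableEq κ]
    [Nonempty κ] (p : ι → κ → Prop) [∀ i, DecidablePred (p i)]
    (hfull : (univ.filter fun i => ∀ k, p i k).card ≤ 1)
    (hsum : 1 + Fintype.card ι * (Fintype.card κ - 1) ≤ ∑ i, (univ.filter (p i)).card) (i : ι) :
    ∃ h, ∀ k, k ≠ h → p i k := by
  have hpos : 0 < Fintype.card κ := Fintype.card_pos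
  have hle : ∀ i, (univ.filter (p i)).card ≤
      (Fintype.card κ - 1) + if ∀ k, p i k then 1 else 0 := by
    intro i
    split_ifs with hi
    · have := Finset.card_le_univ (univ.filter (p i))
      omega
    · push Not at hi
      obtain ⟨k, hk⟩ := hi
      have : (univ.filter (p i)).card < Fintype.card κ :=
        Finset.card_lt_univ_of_notMem (x := k) (by simpa using hk)
      omega
  by_contra! hcon
  obtain ⟨a, -, ha⟩ := hcon (Classical.arbitrary κ)
  obtain ⟨b, hba, hb⟩ := hcon a
  have hlt : (univ.filter (p i)).card <
      (Fintype.card κ - 1) + if ∀ k, p i k then 1 else 0 := by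
    have hsub : univ.filter (p i) ⊆ (univ.erase a).erase b := by
      intro k hk
      have hk' : p i k := (Finset.mem_filter.1 hk).2
      simp only [Finset.mem_erase, Finset.mem_univ, and_true]
      exact ⟨fun h => hb (h ▸ hk'), fun h => ha (h ▸ hk')⟩
    have hc := Finset.card_le_card hsub
    rw [Finset.card_erase_of_mem (by simp [hba]), Finset.card_erase_of_mem (by simp),
      Finset.card_univ] at hc
    have : 1 < Fintype.card κ := Fintype.one_lt_card_iff.2 ⟨b, a, hba⟩
    omega
  have := Finset.sum_lt_sum (fun i _ => hle i) ⟨i, Finset.mem_univ i, hlt⟩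
  rw [Finset.sum_add_distrib, ← Finset.card_filter, Finset.sum_const, Finset.card_univ,
    smul_eq_mul] at this
  omega

/-- Claim 3.3: let `r, s ≥ 3` and `t = r + s − 3`. Suppose that for every clique of
`G` on `s−2` vertices at most one coordinate is `1` on all of them, and
`x₀, …, x_{s−3}` form a clique with total weight `1 + t(s−3)`. Then every common
neighbor `w` of `x₀, …, x_{s−3}` satisfies `‖v(w)‖ ≤ s − 2`. -/
theorem common_neighbor_small_weight (r s : ℕ) (hr : 3 ≤ r) (hs : 3 ≤ s)
    (V : Type) [Fintype V] (G : SimpleGraph V)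
    (v : V → Fin (r + s - 3) → ZMod 2)
    (hcode : ∀ S : Finset V, S.card = s - 2 → G.IsClique (S : Set V) →
      (Finset.univ.filter fun j : Fin (r + s - 3) => ∀ x ∈ S, v x j = 1).card ≤ 1)
    (x : Fin (s - 2) → V) (hinj : Function.Injective x)
    (hclique : G.IsClique (Set.range x))
    (hsum : (∑ j : Fin (s - 2), weight (v (x j))) = 1 + (r + s - 3) * (s - 3)) :
    ∀ w : V, (∀ j : Fin (s - 2), G.Adj (x j) w) → weight (v w) ≤ s - 2 := by
  classical
  intro w hw
  have hadj : ∀ j k, j ≠ k → G.Adj (x j) (x k) := fun j k hjk =>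
    hclique ⟨j, rfl⟩ ⟨k, rfl⟩ (hinj.ne hjk)
  have : Nonempty (Fin (s - 2)) := ⟨⟨0, by omega⟩⟩
  have hone : ∀ i : Fin (r + s - 3), ∃ h, ∀ k, k ≠ h → v (x k) i = 1 := by
    refine exists_forall_ne_of_sum_card (fun i k => v (x k) i = 1) ?_ ?_
    · have := hcode (univ.image x) (by simp [Finset.card_image_of_injective _ hinj])
        (by simpa using hclique)
      convert this using 3
      simp
    · have hswap : ∑ i, (univ.filter fun k => v (x k) i = 1).card =
          ∑ k, weight (v (x k)) := by
        simp only [weight, Finset.card_filter]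
        exact Finset.sum_comm
      rw [hswap, hsum, Fintype.card_fin, Fintype.card_fin, show s - 2 - 1 = s - 3 by omega]
  have hreplace : ∀ h : Fin (s - 2), (univ.filter fun i : Fin (r + s - 3) =>
      v w i = 1 ∧ ∀ k, k ≠ h → v (x k) i = 1).card ≤ 1 := by
    intro h
    have hnot : w ∉ (univ.erase h).image x := by
      intro hmem
      obtain ⟨k, -, rfl⟩ := Finset.mem_image.1 hmem
      exact G.irrefl (hw k)
    have := hcode (insert w ((univ.erase h).image x))
      (by
        rw [Finset.card_insert_of_notMem hnot, Finset.card_image_of_injective _ hinj,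
          Finset.card_erase_of_mem (Finset.mem_univ h), Finset.card_univ, Fintype.card_fin]
        omega)
      (by
        rw [Finset.coe_insert, SimpleGraph.isClique_insert]
        refine ⟨hclique.subset (by simp), ?_⟩
        intro b hb _
        obtain ⟨k, -, rfl⟩ := Finset.mem_image.1 (Finset.mem_coe.1 hb)
        exact (hw k).symm)
    simpa using this
  have hcover : (univ.filter fun i : Fin (r + s - 3) => v w i = 1) ⊆
      univ.biUnion fun h => univ.filter fun i : Fin (r + s - 3) =>
        v w i = 1 ∧ ∀ k, k ≠ h → v (x k) i = 1 := by
    intro i hi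
    obtain ⟨h, hh⟩ := hone i
    exact Finset.mem_biUnion.2 ⟨h, Finset.mem_univ h,
      Finset.mem_filter.2 ⟨Finset.mem_univ i, (Finset.mem_filter.1 hi).2, hh⟩⟩
  calc weight (v w) ≤ _ := Finset.card_le_card hcover
    _ ≤ (univ : Finset (Fin (s - 2))).card * 1 :=
      Finset.card_biUnion_le_card_mul _ _ _ fun h _ => hreplace h
    _ = s - 2 := by simp
end
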